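/- arXiv:2107.13849 — 2 statements merged into one kernel-verified Lean document; each statement's English description precedes it below -/
import Mathlib

section
/- Let a, b ∈ ℝ and let u1, u2, ũ1, ũ2 : ℝ × ℝ → ℂ be smooth functions that solve the coupled NLS equation and, together with Ω, satisfy all four BT equations. Then the time Hamiltonian densities 𝓗_T := (i/2)(conj(u1)·∂t u1 − u1·∂t conj(u1) + conj(u2)·∂t u2 − u2·∂t conj(u2)) + |∂x u1|² + |∂x u2|² + (|u1|²+|u2|²)² and 𝓗̃_T (the same expression with ũ1, ũ2) satisfy 𝓗_T − 𝓗̃_T = ∂t[ (i/2)(conj(u1)·ũ1 − u1·conj(ũ1) + conj(u2)·ũ2 − u2·conj(ũ2) − 6ia·Ω) ]. -/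
open Complex MeasureTheory Filter Topology ComplexConjugate Matrix

noncomputable section

/-- Partial derivative in the first (space) variable. -/
def pdx (f : ℝ × ℝ → ℂ) (p : ℝ × ℝ) : ℂ := deriv (fun x => f (x, p.2)) p.1

/-- Partial derivative in the second (time) variable. -/
def pdt (f : ℝ × ℝ → ℂ) (p : ℝ × ℝ) : ℂ := deriv (fun t => f (p.1, t)) p.2

/-- Squared modulus, as a complex number. -/
def nsq (z : ℂ) : ℂ := (Complex.normSq z : ℂ)

/-- The coupled NLS (Manakov) equation at a point. -/
def CNLSat (u1 u2 : ℝ × ℝ → ℂ) (p : ℝ × ℝ) : Prop :=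
  Complex.I * pdt u1 p + pdx (pdx u1) p + 2 * (nsq (u1 p) + nsq (u2 p)) * u1 p = 0 ∧
  Complex.I * pdt u2 p + pdx (pdx u2) p + 2 * (nsq (u1 p) + nsq (u2 p)) * u2 p = 0

/-- The Lax matrix U. -/
def Umat (u1 u2 : ℝ × ℝ → ℂ) (l : ℂ) (p : ℝ × ℝ) : Matrix (Fin 3) (Fin 3) ℂ :=
  !![-2*I*l, u1 p, u2 p;
     -conj (u1 p), I*l, 0;
     -conj (u2 p), 0, I*l]

/-- The Lax matrix V. -/
def Vmat (u1 u2 : ℝ × ℝ → ℂ) (l : ℂ) (p : ℝ × ℝ) : Matrix (Fin 3) (Fin 3) ℂ :=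
  !![-6*I*l^2 + I*(nsq (u1 p) + nsq (u2 p)), 3*l*u1 p + I * pdx u1 p, 3*l*u2 p + I * pdx u2 p;
     -3*l*conj (u1 p) + I * pdx (fun q => conj (u1 q)) p, 3*I*l^2 - I*nsq (u1 p), -I*conj (u1 p)*u2 p;
     -3*l*conj (u2 p) + I * pdx (fun q => conj (u2 q)) p, -I*u1 p*conj (u2 p), 3*I*l^2 - I*nsq (u2 p)]

/-- The space-part Riccati equations at a point. -/
def SpaceRiccatiAt (u1 u2 : ℝ × ℝ → ℂ) (l : ℂ) (G1 G2 : ℝ × ℝ → ℂ) (p : ℝ × ℝ) : Prop :=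
  pdx G1 p = 3*I*l*G1 p - u1 p*(G1 p)^2 - u2 p*G1 p*G2 p - conj (u1 p) ∧
  pdx G2 p = 3*I*l*G2 p - u2 p*(G2 p)^2 - u1 p*G1 p*G2 p - conj (u2 p)

/-- The time-part Riccati equations at a point. -/
def TimeRiccatiAt (u1 u2 : ℝ × ℝ → ℂ) (l : ℂ) (G1 G2 : ℝ × ℝ → ℂ) (p : ℝ × ℝ) : Prop :=
  pdt G1 p = Vmat u1 u2 l p 1 0 + (Vmat u1 u2 l p 1 1 - Vmat u1 u2 l p 0 0) * G1 p
      + Vmat u1 u2 l p 1 2 * G2 p - Vmat u1 u2 l p 0 1 * (G1 p)^2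
      - Vmat u1 u2 l p 0 2 * G1 p * G2 p ∧
  pdt G2 p = Vmat u1 u2 l p 2 0 + (Vmat u1 u2 l p 2 2 - Vmat u1 u2 l p 0 0) * G2 p
      + Vmat u1 u2 l p 2 1 * G1 p - Vmat u1 u2 l p 0 1 * G1 p * G2 p
      - Vmat u1 u2 l p 0 2 * (G2 p)^2

/-- The frozen Bäcklund matrix B⁰ built from field values and Ω. -/
def frozenB0 (a b : ℝ) (u1 u2 tu1 tu2 : ℂ) (Om : ℝ) : Matrix (Fin 3) (Fin 3) ℂ :=
  !![(a:ℂ) + I/3*(Om:ℂ), I/3*(tu1-u1), I/3*(tu2-u2);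
     -conj (I/3*(tu1-u1)), (a:ℂ) - I*b - nsq (I/3*(tu1-u1))/(I/3*(Om:ℂ) + I*b),
       (-conj (I/3*(tu1-u1))) * (I/3*(tu2-u2)) / (I/3*(Om:ℂ) + I*b);
     -conj (I/3*(tu2-u2)),
       -conj ((-conj (I/3*(tu1-u1))) * (I/3*(tu2-u2)) / (I/3*(Om:ℂ) + I*b)),
       (a:ℂ) - I*b - nsq (I/3*(tu2-u2))/(I/3*(Om:ℂ) + I*b)]

/-- The space part of the Bäcklund transformation at a point. -/
def BTspaceAt (a : ℝ) (u1 u2 tu1 tu2 : ℝ × ℝ → ℂ) (B : Matrix (Fin 3) (Fin 3) ℂ)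
    (Om : ℝ) (p : ℝ × ℝ) : Prop :=
  pdx (fun q => u1 q - tu1 q) p
      = tu1 p * ((Om : ℂ) - 3*I*a) + 3*I*u1 p * B 1 1 + 3*I*u2 p * B 2 1 ∧
  pdx (fun q => u2 q - tu2 q) p
      = tu2 p * ((Om : ℂ) - 3*I*a) + 3*I*u1 p * B 1 2 + 3*I*u2 p * B 2 2

/-- The time part of the Bäcklund transformation at a point. -/
def BTtimeAt (a : ℝ) (u1 u2 tu1 tu2 : ℝ × ℝ → ℂ) (B : Matrix (Fin 3) (Fin 3) ℂ)
    (Om : ℝ) (p : ℝ × ℝ) : Prop :=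
  pdt (fun q => u1 q - tu1 q) p
      = I*(u1 p - tu1 p)*(nsq (u1 p) + nsq (u2 p) + nsq (tu1 p) + nsq (tu2 p))
        + I*(tu1 p*u2 p - u1 p*tu2 p)*conj (tu2 p)
        + I*pdx tu1 p*((Om:ℂ) - 3*I*a) - 3*pdx u1 p*B 1 1 - 3*pdx u2 p*B 2 1 ∧
  pdt (fun q => u2 q - tu2 q) p
      = I*(u2 p - tu2 p)*(nsq (u1 p) + nsq (u2 p) + nsq (tu1 p) + nsq (tu2 p))
        + I*(u1 p*tu2 p - tu1 p*u2 p)*conj (tu1 p)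
        + I*pdx tu2 p*((Om:ℂ) - 3*I*a) - 3*pdx u1 p*B 1 2 - 3*pdx u2 p*B 2 2

/-- The boundary V-matrix built from boundary data p_j (values) and q_j (x-derivatives). -/
def V0mat (p1 p2 q1 q2 : ℝ → ℂ) (t : ℝ) (mu : ℂ) : Matrix (Fin 3) (Fin 3) ℂ :=
  !![-6*I*mu^2 + I*(nsq (p1 t) + nsq (p2 t)), 3*mu*p1 t + I*q1 t, 3*mu*p2 t + I*q2 t;
     -3*mu*conj (p1 t) + I*conj (q1 t), 3*I*mu^2 - I*nsq (p1 t), -I*conj (p1 t)*p2 t;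
     -3*mu*conj (p2 t) + I*conj (q2 t), -I*p1 t*conj (p2 t), 3*I*mu^2 - I*nsq (p2 t)]

section AlgPart

/-- Purely algebraic data of the Bäcklund transformation at a point.  The vector `w = u - ũ` is written
as `w = s y`, and `v, z, c, r` are the conjugates of `u, y, w, p` with `p = u_x`. The time derivative is
`∂t = i D`, so that `D w = T`. -/
structure AlgData (al s O u1 u2 v1 v2 y1 y2 z1 z2 w1 w2 c1 c2 wx1 wx2 cx1 cx2 p1 p2 r1 r2
    T1 T2 S1 S2 : ℂ) : Prop where
  hs : s ≠ 0
  hO : O = s * (1 - (y1*z1+y2*z2)) / 2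
  hw1 : w1 = s*y1
  hw2 : w2 = s*y2
  hc1 : c1 = s*z1
  hc2 : c2 = s*z2
  hwx1 : wx1 = s*u1 - (O-al)*(s*y1) - s*y1*(z1*u1+z2*u2)
  hwx2 : wx2 = s*u2 - (O-al)*(s*y2) - s*y2*(z1*u1+z2*u2)
  hcx1 : cx1 = s*v1 - (O+al)*(s*z1) - s*z1*(y1*v1+y2*v2)
  hcx2 : cx2 = s*v2 - (O+al)*(s*z2) - s*z2*(y1*v1+y2*v2)
  hT1 : T1 = w1*(u1*v1+u2*v2+(u1-w1)*(v1-c1)+(u2-w2)*(v2-c2)) + ((u1-w1)*u2-u1*(u2-w2))*(v2-c2)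
    + s*p1 - wx1*(O-al) - w1*(z1*p1+z2*p2)
  hT2 : T2 = w2*(u1*v1+u2*v2+(u1-w1)*(v1-c1)+(u2-w2)*(v2-c2)) + (u1*(u2-w2)-(u1-w1)*u2)*(v1-c1)
    + s*p2 - wx2*(O-al) - w2*(z1*p1+z2*p2)
  hS1 : S1 = c1*(u1*v1+u2*v2+(u1-w1)*(v1-c1)+(u2-w2)*(v2-c2)) + ((v1-c1)*v2-v1*(v2-c2))*(u2-w2)
    + s*r1 - cx1*(O+al) - c1*(y1*r1+y2*r2)
  hS2 : S2 = c2*(u1*v1+u2*v2+(u1-w1)*(v1-c1)+(u2-w2)*(v2-c2)) + (v1*(v2-c2)-(v1-c1)*v2)*(u1-w1)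
    + s*r2 - cx2*(O+al) - c2*(y1*r1+y2*r2)

variable {al s O u1 u2 v1 v2 y1 y2 z1 z2 w1 w2 c1 c2 wx1 wx2 cx1 cx2 p1 p2 r1 r2 T1 T2 S1 S2 : ℂ}

lemma AlgData.swap (h : AlgData al s O u1 u2 v1 v2 y1 y2 z1 z2 w1 w2 c1 c2 wx1 wx2 cx1 cx2 p1 p2 r1 r2
    T1 T2 S1 S2) : AlgData al s O u2 u1 v2 v1 y2 y1 z2 z1 w2 w1 c2 c1 wx2 wx1 cx2 cx1 p2 p1 r2 r1
    T2 T1 S2 S1 := by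
  obtain ⟨hs, hO, hw1, hw2, hc1, hc2, hwx1, hwx2, hcx1, hcx2, hT1, hT2, hS1, hS2⟩ := h
  exact ⟨hs, by rw [hO]; ring, hw2, hw1, hc2, hc1, by rw [hwx2]; ring, by rw [hwx1]; ring,
    by rw [hcx2]; ring, by rw [hcx1]; ring, by rw [hT2]; ring, by rw [hT1]; ring,
    by rw [hS2]; ring, by rw [hS1]; ring⟩

/-- `|ũ|² - |u|²` -/
def EE (u1 u2 v1 v2 w1 w2 c1 c2 : ℂ) : ℂ := (u1-w1)*(v1-c1)+(u2-w2)*(v2-c2) - u1*v1 - u2*v2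

/-- the `D`-derivative of `Ω` -/
def PP (u1 u2 v1 v2 w1 w2 c1 c2 p1 p2 r1 r2 wx1 wx2 cx1 cx2 : ℂ) : ℂ :=
  (v1-c1)*(p1-wx1) + (v2-c2)*(p2-wx2) - (u1-w1)*(r1-cx1) - (u2-w2)*(r2-cx2)
  - (v1*p1+v2*p2-u1*r1-u2*r2)

/-- the degeneracy vector -/
def KK (s u1 y1 : ℂ) (sg : ℂ) : ℂ := u1 - s*y1 + y1*sg

lemma AlgData.xrel (h : AlgData al s O u1 u2 v1 v2 y1 y2 z1 z2 w1 w2 c1 c2 wx1 wx2 cx1 cx2 p1 p2 r1 r2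
    T1 T2 S1 S2) : 2*O*EE u1 u2 v1 v2 w1 w2 c1 c2 = -(wx1*c1+w1*cx1+wx2*c2+w2*cx2) := by
  obtain ⟨hs, hO, hw1, hw2, hc1, hc2, hwx1, hwx2, hcx1, hcx2, hT1, hT2, hS1, hS2⟩ := h
  subst hO hw1 hw2 hc1 hc2 hwx1 hwx2 hcx1 hcx2
  unfold EE
  ring

lemma AlgData.trel (h : AlgData al s O u1 u2 v1 v2 y1 y2 z1 z2 w1 w2 c1 c2 wx1 wx2 cx1 cx2 p1 p2 r1 r2
    T1 T2 S1 S2) : 2*O*PP u1 u2 v1 v2 w1 w2 c1 c2 p1 p2 r1 r2 wx1 wx2 cx1 cx2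
      = -(T1*c1-w1*S1+T2*c2-w2*S2) := by
  obtain ⟨hs, hO, hw1, hw2, hc1, hc2, hwx1, hwx2, hcx1, hcx2, hT1, hT2, hS1, hS2⟩ := h
  subst hO hw1 hw2 hc1 hc2 hwx1 hwx2 hcx1 hcx2 hT1 hT2 hS1 hS2
  unfold PP
  ring

lemma AlgData.xcompat (h : AlgData al s O u1 u2 v1 v2 y1 y2 z1 z2 w1 w2 c1 c2 wx1 wx2 cx1 cx2 p1 p2 r1 r2
    T1 T2 S1 S2) {ox wxx1 : ℂ} (hxx : wxx1 = T1 - 2*(u1*v1+u2*v2)*u1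
      + 2*((u1-w1)*(v1-c1)+(u2-w2)*(v2-c2))*(u1-w1))
    (hd : ox*wx1 + s*wxx1 = 2*s*ox*u1 + s^2*p1 - (ox*(s*w1) + (O-al)*(ox*w1+s*wx1))
      - (wx1*(c1*u1+c2*u2) + w1*(cx1*u1+c1*p1+cx2*u2+c2*p2))) :
    (ox - EE u1 u2 v1 v2 w1 w2 c1 c2) * KK s u1 y1 (z1*u1+z2*u2) = 0 := by
  obtain ⟨hs, hO, hw1, hw2, hc1, hc2, hwx1, hwx2, hcx1, hcx2, hT1, hT2, hS1, hS2⟩ := h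
  subst hO hw1 hw2 hc1 hc2 hwx1 hwx2 hcx1 hcx2 hT1 hT2 hS1 hS2 hxx
  apply mul_left_cancel₀ hs
  unfold EE KK
  linear_combination -hd

lemma AlgData.tcompat (h : AlgData al s O u1 u2 v1 v2 y1 y2 z1 z2 w1 w2 c1 c2 wx1 wx2 cx1 cx2 p1 p2 r1 r2
    T1 T2 S1 S2) {ox od wxx1 wxd q1 q2 ud1 ud2 : ℂ} (hxx : wxx1 = T1 - 2*(u1*v1+u2*v2)*u1
      + 2*((u1-w1)*(v1-c1)+(u2-w2)*(v2-c2))*(u1-w1))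
    (hox : ox = EE u1 u2 v1 v2 w1 w2 c1 c2)
    (hud1 : ud1 = q1 + 2*(u1*v1+u2*v2)*u1) (hud2 : ud2 = q2 + 2*(u1*v1+u2*v2)*u2)
    (hd : od*wx1 + s*wxd = 2*s*od*u1 + s^2*ud1 - (od*(s*w1) + (O-al)*(od*w1+s*T1))
      - (T1*(c1*u1+c2*u2) + w1*(-S1*u1+c1*ud1-S2*u2+c2*ud2)))
    (hx : ox*T1 + s*wxd
      = (ox*w1+s*wx1)*(u1*v1+u2*v2+(u1-w1)*(v1-c1)+(u2-w2)*(v2-c2))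
        + s*w1*(p1*v1+u1*r1+p2*v2+u2*r2+(p1-wx1)*(v1-c1)+(u1-w1)*(r1-cx1)
          +(p2-wx2)*(v2-c2)+(u2-w2)*(r2-cx2))
        + ox*(((u1-w1)*u2-u1*(u2-w2))*(v2-c2))
        + s*(((p1-wx1)*u2+(u1-w1)*p2-p1*(u2-w2)-u1*(p2-wx2))*(v2-c2)
          + ((u1-w1)*u2-u1*(u2-w2))*(r2-cx2))
        + 2*s*ox*p1 + s^2*q1 - (ox*wx1+s*wxx1)*(O-al) - s*wx1*ox
        - (wx1*(c1*p1+c2*p2) + w1*(cx1*p1+c1*q1+cx2*p2+c2*q2))) :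
    (od - PP u1 u2 v1 v2 w1 w2 c1 c2 p1 p2 r1 r2 wx1 wx2 cx1 cx2) * KK s u1 y1 (z1*u1+z2*u2) = 0 := by
  obtain ⟨hs, hO, hw1, hw2, hc1, hc2, hwx1, hwx2, hcx1, hcx2, hT1, hT2, hS1, hS2⟩ := h
  subst hO hw1 hw2 hc1 hc2 hwx1 hwx2 hcx1 hcx2 hT1 hT2 hS1 hS2 hxx hud1 hud2 hox
  apply mul_left_cancel₀ hs
  unfold EE PP KK at *
  linear_combination hx-hd

lemma AlgData.degen (h : AlgData al s O u1 u2 v1 v2 y1 y2 z1 z2 w1 w2 c1 c2 wx1 wx2 cx1 cx2 p1 p2 r1 r2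
    T1 T2 S1 S2) (hO0 : O = 0) (hK1 : KK s u1 y1 (z1*u1+z2*u2) = 0)
    (hK2 : KK s u2 y2 (z1*u1+z2*u2) = 0) : 2*u1-w1 = 0 ∧ 2*u2-w2=0 := by
  obtain ⟨hs, hO, hw1, hw2, hc1, hc2, hwx1, hwx2, hcx1, hcx2, hT1, hT2, hS1, hS2⟩ := h
  have hY : y1*z1+y2*z2 = 1 := by
    rw [hO0] at hO
    apply mul_left_cancel₀ hs
    linear_combination 2*hO
  unfold KK at *
  have hsg : z1*u1+z2*u2 = s/2 := by
    linear_combination (1/2)*(z1*hK1+z2*hK2) + (s-(z1*u1+z2*u2))/2*hY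
  rw [hsg] at hK1 hK2
  rw [hw1, hw2]
  exact ⟨by linear_combination 2*hK1, by linear_combination 2*hK2⟩

/-- the final identity, divided by `i`-s -/
lemma AlgData.final (h : AlgData al s O u1 u2 v1 v2 y1 y2 z1 z2 w1 w2 c1 c2 wx1 wx2 cx1 cx2 p1 p2 r1 r2
    T1 T2 S1 S2) : 
    - (1/2) * ((2*v1-c1)*T1 + (2*u1-w1)*S1 + (2*v2-c2)*T2 + (2*u2-w2)*S2)
    + p1*r1+p2*r2+(u1*v1+u2*v2)^2 - (p1-wx1)*(r1-cx1) - (p2-wx2)*(r2-cx2)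
      - ((u1-w1)*(v1-c1)+(u2-w2)*(v2-c2))^2
     = al * PP u1 u2 v1 v2 w1 w2 c1 c2 p1 p2 r1 r2 wx1 wx2 cx1 cx2 := by
  obtain ⟨hs, hO, hw1, hw2, hc1, hc2, hwx1, hwx2, hcx1, hcx2, hT1, hT2, hS1, hS2⟩ := h
  subst hO hw1 hw2 hc1 hc2 hwx1 hwx2 hcx1 hcx2 hT1 hT2 hS1 hS2
  unfold PP
  ring

end AlgPart

lemma pdx_hasDeriv {f : ℝ × ℝ → ℂ} (hf : Differentiable ℝ f) (p : ℝ × ℝ) :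
    HasDerivAt (fun x => f (x, p.2)) (pdx f p) p.1 := by
  have : Differentiable ℝ (fun x : ℝ => f (x, p.2)) := by fun_prop
  exact (this p.1).hasDerivAt

lemma pdt_hasDeriv {f : ℝ × ℝ → ℂ} (hf : Differentiable ℝ f) (p : ℝ × ℝ) :
    HasDerivAt (fun t => f (p.1, t)) (pdt f p) p.2 := by
  have : Differentiable ℝ (fun x : ℝ => f (p.1, x)) := by fun_prop
  exact (this p.2).hasDerivAt

lemma pdx_eq_fderiv {f : ℝ × ℝ → ℂ} (hf : Differentiable ℝ f) (p : ℝ × ℝ) :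
    pdx f p = fderiv ℝ f p (1, 0) := by
  have h1 : HasDerivAt (fun x : ℝ => (x, p.2)) ((1:ℝ), (0:ℝ)) p.1 :=
    (hasDerivAt_id p.1).prodMk (hasDerivAt_const p.1 p.2)
  have h2 := HasFDerivAt.comp_hasDerivAt (f := fun x : ℝ => (x, p.2)) p.1 (hf p).hasFDerivAt h1
  exact h2.deriv

lemma pdt_eq_fderiv {f : ℝ × ℝ → ℂ} (hf : Differentiable ℝ f) (p : ℝ × ℝ) :
    pdt f p = fderiv ℝ f p (0, 1) := by
  have h1 : HasDerivAt (fun x : ℝ => (p.1, x)) ((0:ℝ), (1:ℝ)) p.2 :=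
    (hasDerivAt_const p.2 p.1).prodMk (hasDerivAt_id p.2)
  have h2 := HasFDerivAt.comp_hasDerivAt (f := fun x : ℝ => (p.1, x)) p.2 (hf p).hasFDerivAt h1
  exact h2.deriv

/-- smoothness, abbreviated -/
def Smo (f : ℝ × ℝ → ℂ) : Prop := ContDiff ℝ (⊤ : ℕ∞) f

lemma Smo.diff {f : ℝ × ℝ → ℂ} (hf : Smo f) : Differentiable ℝ f :=
  ContDiff.differentiable hf (by simp)

lemma Smo.pdx {f : ℝ × ℝ → ℂ} (hf : Smo f) : Smo (pdx f) := by
  have : _root_.pdx f = fun p => fderiv ℝ f p (1, 0) := funext (pdx_eq_fderiv hf.diff)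
  rw [Smo, this]
  exact (ContDiff.fderiv_right (m := (⊤ : ℕ∞)) hf (by simp)).clm_apply contDiff_const

lemma Smo.pdt {f : ℝ × ℝ → ℂ} (hf : Smo f) : Smo (pdt f) := by
  have : _root_.pdt f = fun p => fderiv ℝ f p (0, 1) := funext (pdt_eq_fderiv hf.diff)
  rw [Smo, this]
  exact (ContDiff.fderiv_right (m := (⊤ : ℕ∞)) hf (by simp)).clm_apply contDiff_const

lemma Smo.comm {f : ℝ × ℝ → ℂ} (hf : Smo f) (p : ℝ × ℝ) : _root_.pdx (_root_.pdt f) p = _root_.pdt (_root_.pdx f) p := by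
  rw [pdx_eq_fderiv hf.pdt.diff, pdt_eq_fderiv hf.pdx.diff]
  have h1 : _root_.pdx f = fun p => fderiv ℝ f p (1, 0) := funext (pdx_eq_fderiv hf.diff)
  have h2 : _root_.pdt f = fun p => fderiv ℝ f p (0, 1) := funext (pdt_eq_fderiv hf.diff)
  have hd : DifferentiableAt ℝ (fderiv ℝ f) p :=
    ((ContDiff.fderiv_right (m := (⊤ : ℕ∞)) hf (by simp)).differentiable (by simp)) p
  have hsym : IsSymmSndFDerivAt ℝ f p := by
    apply ContDiffAt.isSymmSndFDerivAt (n := (⊤ : ℕ∞)) (ContDiff.contDiffAt hf)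
    simp only [minSmoothness_of_isRCLikeNormedField]
    have h2 : ((2 : ℕ∞) : WithTop ℕ∞) ≤ ((⊤ : ℕ∞) : WithTop ℕ∞) := WithTop.coe_le_coe.2 le_top
    exact h2
  rw [h1, h2, fderiv_clm_apply hd (differentiableAt_const _), fderiv_clm_apply hd (differentiableAt_const _)]
  simp
  exact hsym.eq _ _

lemma HasDerivAt.cj {f : ℝ → ℂ} {f' : ℂ} {x : ℝ} (h : HasDerivAt f f' x) :
    HasDerivAt (fun x => conj (f x)) (conj f') x := by simpa using h.star

lemma pdx_conj {f : ℝ × ℝ → ℂ} (hf : Differentiable ℝ f) (p : ℝ × ℝ) :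
    pdx (fun q => conj (f q)) p = conj (pdx f p) := (pdx_hasDeriv hf p).cj.deriv

lemma pdt_conj {f : ℝ × ℝ → ℂ} (hf : Differentiable ℝ f) (p : ℝ × ℝ) :
    pdt (fun q => conj (f q)) p = conj (pdt f p) := (pdt_hasDeriv hf p).cj.deriv

lemma dX_aux {s g O u1 u2 w1 c1 c2 : ℝ → ℂ} {al : ℂ} {s' g' u1' u2' w1' c1' c2' : ℂ} {t : ℝ}
    (hs : HasDerivAt s s' t) (hg : HasDerivAt g g' t) (hO : HasDerivAt O s' t)
    (hu1 : HasDerivAt u1 u1' t) (hu2 : HasDerivAt u2 u2' t) (hw1 : HasDerivAt w1 w1' t)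
    (hc1 : HasDerivAt c1 c1' t) (hc2 : HasDerivAt c2 c2' t)
    (h : ∀ t, s t * g t = s t^2*u1 t - (O t - al)*(s t*w1 t) - w1 t*(c1 t*u1 t+c2 t*u2 t)) :
    s'*g t + s t*g' = 2*s t*s'*u1 t + s t^2*u1' - (s'*(s t*w1 t) + (O t-al)*(s'*w1 t+s t*w1'))
      - (w1'*(c1 t*u1 t+c2 t*u2 t) + w1 t*(c1'*u1 t+c1 t*u1'+c2'*u2 t+c2 t*u2')) := by
  have h1 := hs.mul hg
  have h2 := (((hs.pow 2).mul hu1).sub ((hO.sub_const al).mul (hs.mul hw1))).sub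
    (hw1.mul ((hc1.mul hu1).add (hc2.mul hu2)))
  have he : (s * g) = (s^2*u1 - (fun t => O t - al)*(s*w1) - w1*(c1*u1+c2*u2)) := by
    funext t; simpa using h t
  rw [he] at h1
  have := h1.unique h2
  simp at this
  linear_combination this

lemma dT_aux {s T O u1 u2 w1 w2 v1 v2 c1 c2 p1 p2 g : ℝ → ℂ} {al : ℂ}
    {s' T' u1' u2' w1' w2' v1' v2' c1' c2' p1' p2' g' : ℂ} {t : ℝ}
    (hs : HasDerivAt s s' t) (hT : HasDerivAt T T' t) (hO : HasDerivAt O s' t)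
    (hu1 : HasDerivAt u1 u1' t) (hu2 : HasDerivAt u2 u2' t) (hw1 : HasDerivAt w1 w1' t)
    (hw2 : HasDerivAt w2 w2' t) (hv1 : HasDerivAt v1 v1' t) (hv2 : HasDerivAt v2 v2' t)
    (hc1 : HasDerivAt c1 c1' t) (hc2 : HasDerivAt c2 c2' t)
    (hp1 : HasDerivAt p1 p1' t) (hp2 : HasDerivAt p2 p2' t) (hg : HasDerivAt g g' t)
    (h : ∀ t, s t * T t = s t*w1 t*(u1 t*v1 t+u2 t*v2 t+(u1 t-w1 t)*(v1 t-c1 t)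
        +(u2 t-w2 t)*(v2 t-c2 t))
      + s t*(((u1 t-w1 t)*u2 t-u1 t*(u2 t-w2 t))*(v2 t-c2 t))
      + s t^2*p1 t - s t*g t*(O t-al) - w1 t*(c1 t*p1 t+c2 t*p2 t)) :
    s'*T t + s t*T'
      = (s'*w1 t+s t*w1')*(u1 t*v1 t+u2 t*v2 t+(u1 t-w1 t)*(v1 t-c1 t)+(u2 t-w2 t)*(v2 t-c2 t))
        + s t*w1 t*(u1'*v1 t+u1 t*v1'+u2'*v2 t+u2 t*v2'+(u1'-w1')*(v1 t-c1 t)+(u1 t-w1 t)*(v1'-c1')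
          +(u2'-w2')*(v2 t-c2 t)+(u2 t-w2 t)*(v2'-c2'))
        + s'*(((u1 t-w1 t)*u2 t-u1 t*(u2 t-w2 t))*(v2 t-c2 t))
        + s t*(((u1'-w1')*u2 t+(u1 t-w1 t)*u2'-u1'*(u2 t-w2 t)-u1 t*(u2'-w2'))*(v2 t-c2 t)
          + ((u1 t-w1 t)*u2 t-u1 t*(u2 t-w2 t))*(v2'-c2'))
        + 2*s t*s'*p1 t + s t^2*p1' - (s'*g t+s t*g')*(O t-al) - s t*g t*s'
        - (w1'*(c1 t*p1 t+c2 t*p2 t) + w1 t*(c1'*p1 t+c1 t*p1'+c2'*p2 t+c2 t*p2')) := by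
  have h1 := hs.mul hT
  have h2 := (((((hs.mul hw1).mul ((((hu1.mul hv1).add (hu2.mul hv2)).add
      ((hu1.sub hw1).mul (hv1.sub hc1))).add ((hu2.sub hw2).mul (hv2.sub hc2)))).add
      (hs.mul ((((hu1.sub hw1).mul hu2).sub (hu1.mul (hu2.sub hw2))).mul (hv2.sub hc2)))).add
      ((hs.pow 2).mul hp1)).sub ((hs.mul hg).mul (hO.sub_const al))).sub
      (hw1.mul ((hc1.mul hp1).add (hc2.mul hp2)))
  have he : (s * T) = s*w1*(u1*v1+u2*v2+(u1-w1)*(v1-c1)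
        +(u2-w2)*(v2-c2))
      + s*(((u1-w1)*u2-u1*(u2-w2))*(v2-c2))
      + s^2*p1 - s*g*(fun t => O t-al) - w1*(c1*p1+c2*p2) := by
    funext t; simpa using h t
  rw [he] at h1
  have := h1.unique h2
  simp at this
  linear_combination this

lemma deriv_eq_of_punctured {f g : ℝ → ℂ} {f' : ℝ → ℂ} {x0 : ℝ} (hf : ∀ x, HasDerivAt f (f' x) x)
    (hg : ContinuousAt g x0) (h : ∀ᶠ x in 𝓝[≠] x0, f' x = g x) : f' x0 = g x0 := by
  have h' : ∀ᶠ x in 𝓝[>] x0, f' x = g x := h.filter_mono (nhdsGT_le_nhdsNE x0)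
  have ht : Tendsto (fun x => deriv f x) (𝓝[>] x0) (𝓝 (g x0)) := by
    refine Tendsto.congr' ?_ (hg.tendsto.mono_left nhdsWithin_le_nhds)
    filter_upwards [h'] with x hx
    rw [(hf x).deriv, hx]
  have hd : Differentiable ℝ f := fun x => (hf x).differentiableAt
  have := hasDerivWithinAt_Ici_of_tendsto_deriv (s := Set.Ioi x0) hd.differentiableOn
    (hd.continuous.continuousWithinAt) self_mem_nhdsWithin ht
  exact (uniqueDiffOn_Ici x0 x0 Set.self_mem_Ici).eq_deriv _ (hf x0).hasDerivWithinAt this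

/-- If the `x`-derivative of `f` is smooth, its `t`-derivative is continuous in `x`. -/
lemma pdt_tendsto {f E : ℝ × ℝ → ℂ} (hf : Differentiable ℝ f) (hE : Smo E)
    (h : ∀ p, pdx f p = E p) (x0 t0 : ℝ) :
    Tendsto (fun x => pdt f (x, t0)) (𝓝 x0) (𝓝 (pdt f (x0, t0))) := by
  obtain ⟨M, V, hV, hL⟩ := (ContDiff.contDiffAt (n := 1) (ContDiff.of_le hE (by simp))
    (x := (x0, t0))).exists_lipschitzOnWith
  obtain ⟨r, hr, hrV⟩ := Metric.mem_nhds_iff.1 hV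
  have key : ∀ x ∈ Metric.ball x0 r, ‖pdt f (x, t0) - pdt f (x0, t0)‖ ≤ M * ‖x - x0‖ := by
    intro x hx
    have hd := (pdt_hasDeriv hf (x, t0)).sub (pdt_hasDeriv hf (x0, t0))
    refine hd.le_of_lip' (by positivity) ?_
    filter_upwards [Metric.ball_mem_nhds t0 hr] with t ht
    have hmv := (convex_ball x0 r).norm_image_sub_le_of_norm_hasDerivWithin_le
      (f := fun x => f (x, t) - f (x, t0)) (f' := fun x => E (x, t) - E (x, t0))
      (C := M * ‖t - t0‖) (x := x0) (y := x)
      (fun y _ => by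
        have h1 := (pdx_hasDeriv hf (y, t)).sub (pdx_hasDeriv hf (y, t0))
        rw [h, h] at h1
        exact h1.hasDerivWithinAt)
      (fun y hy => by
        have := hL.norm_sub_le (x := (y, t)) (y := (y, t0)) ?_ ?_
        · simpa using this
        · apply hrV
          rw [← ball_prod_same]
          exact ⟨hy, ht⟩
        · apply hrV
          rw [← ball_prod_same]
          exact ⟨hy, Metric.mem_ball_self hr⟩)
      (Metric.mem_ball_self hr) hx
    simp only [Pi.sub_apply]
    calc _ = ‖f (x, t) - f (x, t0) - (f (x0, t) - f (x0, t0))‖ := by congr 1; ring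
      _ ≤ _ := hmv
      _ = _ := by ring
  rw [tendsto_iff_norm_sub_tendsto_zero]
  refine squeeze_zero' (Eventually.of_forall fun _ => norm_nonneg _) 
    (g := fun x => M * ‖x - x0‖) ?_ ?_
  · filter_upwards [Metric.ball_mem_nhds x0 hr] with x hx using key x hx
  · have : Continuous (fun x : ℝ => (M:ℝ) * ‖x - x0‖) := by fun_prop
    simpa using this.tendsto x0

/-- The solution data, with `w = u - ũ`, denominators cleared, and `O` complex valued. -/
structure BTSol (al c : ℂ) (u1 u2 w1 w2 O : ℝ × ℝ → ℂ) : Prop where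
  su1 : Smo u1
  su2 : Smo u2
  sw1 : Smo w1
  sw2 : Smo w2
  dO : Differentiable ℝ O
  cal : conj al = -al
  cc : conj c = c
  cO : ∀ p, conj (O p) = O p
  hs : ∀ p, O p + c ≠ 0
  rel : ∀ p, O p ^ 2 = c ^ 2 - w1 p * conj (w1 p) - w2 p * conj (w2 p)
  X1 : ∀ p, (O p + c) * pdx w1 p = (O p + c)^2*u1 p - (O p - al)*((O p + c)*w1 p)
    - w1 p*(conj (w1 p)*u1 p+conj (w2 p)*u2 p)
  X2 : ∀ p, (O p + c) * pdx w2 p = (O p + c)^2*u2 p - (O p - al)*((O p + c)*w2 p)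
    - w2 p*(conj (w2 p)*u2 p+conj (w1 p)*u1 p)
  T1 : ∀ p, (O p + c) * (-I * pdt w1 p) =
    (O p + c)*w1 p*(u1 p*conj (u1 p)+u2 p*conj (u2 p)+(u1 p-w1 p)*(conj (u1 p)-conj (w1 p))
        +(u2 p-w2 p)*(conj (u2 p)-conj (w2 p)))
      + (O p + c)*(((u1 p-w1 p)*u2 p-u1 p*(u2 p-w2 p))*(conj (u2 p)-conj (w2 p)))
      + (O p + c)^2*pdx u1 p - (O p + c)*pdx w1 p*(O p-al)
      - w1 p*(conj (w1 p)*pdx u1 p+conj (w2 p)*pdx u2 p)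
  T2 : ∀ p, (O p + c) * (-I * pdt w2 p) =
    (O p + c)*w2 p*(u2 p*conj (u2 p)+u1 p*conj (u1 p)+(u2 p-w2 p)*(conj (u2 p)-conj (w2 p))
        +(u1 p-w1 p)*(conj (u1 p)-conj (w1 p)))
      + (O p + c)*(((u2 p-w2 p)*u1 p-u2 p*(u1 p-w1 p))*(conj (u1 p)-conj (w1 p)))
      + (O p + c)^2*pdx u2 p - (O p + c)*pdx w2 p*(O p-al)
      - w2 p*(conj (w2 p)*pdx u2 p+conj (w1 p)*pdx u1 p)
  N1 : ∀ p, pdx (pdx w1) p = -I * pdt w1 p - 2*(u1 p*conj (u1 p)+u2 p*conj (u2 p))*u1 p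
      + 2*((u1 p-w1 p)*(conj (u1 p)-conj (w1 p))+(u2 p-w2 p)*(conj (u2 p)-conj (w2 p)))*(u1 p-w1 p)
  N2 : ∀ p, pdx (pdx w2) p = -I * pdt w2 p - 2*(u2 p*conj (u2 p)+u1 p*conj (u1 p))*u2 p
      + 2*((u2 p-w2 p)*(conj (u2 p)-conj (w2 p))+(u1 p-w1 p)*(conj (u1 p)-conj (w1 p)))*(u2 p-w2 p)
  M1 : ∀ p, -I * pdt u1 p = pdx (pdx u1) p + 2*(u1 p*conj (u1 p)+u2 p*conj (u2 p))*u1 p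
  M2 : ∀ p, -I * pdt u2 p = pdx (pdx u2) p + 2*(u2 p*conj (u2 p)+u1 p*conj (u1 p))*u2 p

namespace BTSol

variable {al c : ℂ} {u1 u2 w1 w2 O : ℝ × ℝ → ℂ}

lemma swap (h : BTSol al c u1 u2 w1 w2 O) : BTSol al c u2 u1 w2 w1 O :=
  ⟨h.su2, h.su1, h.sw2, h.sw1, h.dO, h.cal, h.cc, h.cO, h.hs, fun p => by rw [h.rel p]; ring,
    h.X2, h.X1, h.T2, h.T1, h.N2, h.N1, h.M2, h.M1⟩

lemma wx_formula (h : BTSol al c u1 u2 w1 w2 O) (p : ℝ × ℝ) :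
    pdx w1 p = (O p + c)*u1 p - (O p-al)*((O p + c)*(w1 p/(O p + c)))
      - (O p + c)*(w1 p/(O p + c))*((conj (w1 p)/(O p + c))*u1 p+(conj (w2 p)/(O p + c))*u2 p) := by
  have hs := h.hs p
  apply mul_left_cancel₀ hs
  rw [h.X1 p]
  field_simp

lemma T_formula (h : BTSol al c u1 u2 w1 w2 O) (p : ℝ × ℝ) :
    -I * pdt w1 p = w1 p*(u1 p*conj (u1 p)+u2 p*conj (u2 p)+(u1 p-w1 p)*(conj (u1 p)-conj (w1 p))
        +(u2 p-w2 p)*(conj (u2 p)-conj (w2 p)))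
      + ((u1 p-w1 p)*u2 p-u1 p*(u2 p-w2 p))*(conj (u2 p)-conj (w2 p))
      + (O p + c)*pdx u1 p - pdx w1 p*(O p-al)
      - w1 p*(conj (w1 p)/(O p + c)*pdx u1 p+conj (w2 p)/(O p + c)*pdx u2 p) := by
  have hs := h.hs p
  apply mul_left_cancel₀ hs
  rw [h.T1 p]
  field_simp

lemma conj_s (h : BTSol al c u1 u2 w1 w2 O) (p : ℝ × ℝ) : conj (O p + c) = O p + c := by
  rw [map_add, h.cO, h.cc]

lemma alg (h : BTSol al c u1 u2 w1 w2 O) (p : ℝ × ℝ) :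
    AlgData al (O p + c) (O p) (u1 p) (u2 p) (conj (u1 p)) (conj (u2 p))
      (w1 p/(O p + c)) (w2 p/(O p + c)) (conj (w1 p)/(O p + c)) (conj (w2 p)/(O p + c))
      (w1 p) (w2 p) (conj (w1 p)) (conj (w2 p)) (pdx w1 p) (pdx w2 p)
      (conj (pdx w1 p)) (conj (pdx w2 p)) (pdx u1 p) (pdx u2 p)
      (conj (pdx u1 p)) (conj (pdx u2 p)) (-I*pdt w1 p) (-I*pdt w2 p)
      (conj (-I*pdt w1 p)) (conj (-I*pdt w2 p)) := by
  have hs := h.hs p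
  have hX1 := h.wx_formula p
  have hX2 := h.swap.wx_formula p
  have hT1 := h.T_formula p
  have hT2 := h.swap.T_formula p
  have gX1 := congrArg (starRingEnd ℂ) hX1
  have gX2 := congrArg (starRingEnd ℂ) hX2
  have gT1 := congrArg (starRingEnd ℂ) hT1
  have gT2 := congrArg (starRingEnd ℂ) hT2
  simp only [map_add, map_sub, map_mul, map_div₀, Complex.conj_conj, h.cO, h.cc, h.cal]
    at gX1 gX2
  rw [map_mul (starRingEnd ℂ)] at gT1 gT2
  simp only [map_add, map_sub, map_mul, map_div₀, Complex.conj_conj, h.cO, h.cc, h.cal]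
    at gT1 gT2
  refine ⟨hs, ?_, ?_, ?_, ?_, ?_, hX1, ?_, ?_, ?_, hT1, ?_, ?_, ?_⟩
  · have := h.rel p
    field_simp
    linear_combination this
  · field_simp
  · field_simp
  · field_simp
  · field_simp
  · rw [hX2]; ring
  · rw [gX1]; ring
  · rw [gX2]; ring
  · rw [hT2]; ring
  · rw [map_mul, gT1]; ring
  · rw [map_mul, gT2]; ring

/-- expected `x`-derivative of `O` -/
def E (u1 u2 w1 w2 : ℝ × ℝ → ℂ) (p : ℝ × ℝ) : ℂ :=
  EE (u1 p) (u2 p) (conj (u1 p)) (conj (u2 p)) (w1 p) (w2 p) (conj (w1 p)) (conj (w2 p))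

/-- expected `-i ∂t`-derivative of `O` -/
def P (u1 u2 w1 w2 : ℝ × ℝ → ℂ) (p : ℝ × ℝ) : ℂ :=
  PP (u1 p) (u2 p) (conj (u1 p)) (conj (u2 p)) (w1 p) (w2 p) (conj (w1 p)) (conj (w2 p))
    (pdx u1 p) (pdx u2 p) (conj (pdx u1 p)) (conj (pdx u2 p)) (pdx w1 p) (pdx w2 p)
      (conj (pdx w1 p)) (conj (pdx w2 p))

/-- degeneracy vector component -/
def K (c : ℂ) (u1 u2 w1 w2 O : ℝ × ℝ → ℂ) (p : ℝ × ℝ) : ℂ :=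
  KK (O p + c) (u1 p) (w1 p/(O p + c))
    (conj (w1 p)/(O p + c) * u1 p + conj (w2 p)/(O p + c) * u2 p)

lemma E_swap (p : ℝ × ℝ) : E u2 u1 w2 w1 p = E u1 u2 w1 w2 p := by
  unfold E EE; ring

lemma P_swap (p : ℝ × ℝ) : P u2 u1 w2 w1 p = P u1 u2 w1 w2 p := by
  unfold P PP; ring

lemma smo_conj {f : ℝ × ℝ → ℂ} (hf : Smo f) : Smo (fun p => conj (f p)) :=
  Complex.conjCLE.contDiff.comp hf

lemma smo_E (h : BTSol al c u1 u2 w1 w2 O) : Smo (E u1 u2 w1 w2) := by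
  have a1 : ContDiff ℝ (⊤ : ℕ∞) u1 := h.su1
  have a2 : ContDiff ℝ (⊤ : ℕ∞) u2 := h.su2
  have a3 : ContDiff ℝ (⊤ : ℕ∞) w1 := h.sw1
  have a4 : ContDiff ℝ (⊤ : ℕ∞) w2 := h.sw2
  have b1 : ContDiff ℝ (⊤ : ℕ∞) _ := smo_conj h.su1
  have b2 : ContDiff ℝ (⊤ : ℕ∞) _ := smo_conj h.su2
  have b3 : ContDiff ℝ (⊤ : ℕ∞) _ := smo_conj h.sw1
  have b4 : ContDiff ℝ (⊤ : ℕ∞) _ := smo_conj h.sw2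
  show ContDiff ℝ (⊤ : ℕ∞) _
  unfold E EE
  fun_prop

lemma cont_P (h : BTSol al c u1 u2 w1 w2 O) : Continuous (P u1 u2 w1 w2) := by
  have a1 := h.su1.diff.continuous
  have a2 := h.su2.diff.continuous
  have a3 := h.sw1.diff.continuous
  have a4 := h.sw2.diff.continuous
  have b1 := h.su1.pdx.diff.continuous
  have b2 := h.su2.pdx.diff.continuous
  have b3 := h.sw1.pdx.diff.continuous
  have b4 := h.sw2.pdx.diff.continuous
  have cj : Continuous (starRingEnd ℂ) := Complex.continuous_conj
  unfold P PP
  fun_prop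

lemma dxO (h : BTSol al c u1 u2 w1 w2 O) (p : ℝ × ℝ) :
    O p * pdx O p = O p * E u1 u2 w1 w2 p := by
  have h1 := (pdx_hasDeriv h.dO p).pow 2
  have hw1 := pdx_hasDeriv h.sw1.diff p
  have hw2 := pdx_hasDeriv h.sw2.diff p
  have h2 := (((hasDerivAt_const p.1 (c^2)).sub (hw1.mul hw1.cj)).sub (hw2.mul hw2.cj))
  have he : (fun x => O (x, p.2)) ^ 2 = (fun _ => c^2) - (fun x => w1 (x, p.2)) * (fun x => conj (w1 (x, p.2)))
      - (fun x => w2 (x, p.2)) * (fun x => conj (w2 (x, p.2))) := by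
    funext x; simpa using h.rel (x, p.2)
  rw [he] at h1
  have h3 := h1.unique h2
  simp at h3
  have h4 := (h.alg p).xrel
  unfold E
  linear_combination (1/2)*h3 - (1/2) * h4

lemma dtO (h : BTSol al c u1 u2 w1 w2 O) (p : ℝ × ℝ) :
    O p * (-I*pdt O p) = O p * P u1 u2 w1 w2 p := by
  have h1 := (pdt_hasDeriv h.dO p).pow 2
  have hw1 := pdt_hasDeriv h.sw1.diff p
  have hw2 := pdt_hasDeriv h.sw2.diff p
  have h2 := (((hasDerivAt_const p.2 (c^2)).sub (hw1.mul hw1.cj)).sub (hw2.mul hw2.cj))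
  have he : (fun x => O (p.1, x)) ^ 2 = (fun _ => c^2) - (fun x => w1 (p.1, x)) * (fun x => conj (w1 (p.1, x)))
      - (fun x => w2 (p.1, x)) * (fun x => conj (w2 (p.1, x))) := by
    funext x; simpa using h.rel (p.1, x)
  rw [he] at h1
  have h3 := h1.unique h2
  simp at h3
  have h4 := (h.alg p).trel
  simp only [map_mul, map_neg, Complex.conj_I] at h4
  unfold P
  linear_combination (-I/2)*h3 - (1/2) * h4

lemma xK (h : BTSol al c u1 u2 w1 w2 O) (p : ℝ × ℝ) :
    (pdx O p - E u1 u2 w1 w2 p) * K c u1 u2 w1 w2 O p = 0 := by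
  have hw1 := pdx_hasDeriv h.sw1.diff p
  have hw2 := pdx_hasDeriv h.sw2.diff p
  have hO := pdx_hasDeriv h.dO p
  have hd := dX_aux (hO.add_const c) (pdx_hasDeriv h.sw1.pdx.diff p) hO
    (pdx_hasDeriv h.su1.diff p) (pdx_hasDeriv h.su2.diff p) hw1 hw1.cj hw2.cj
    (fun x => h.X1 (x, p.2))
  exact (h.alg p).xcompat (h.N1 p) hd

lemma tK (h : BTSol al c u1 u2 w1 w2 O) (p : ℝ × ℝ) (hE : pdx O p = E u1 u2 w1 w2 p) :
    (-I * pdt O p - P u1 u2 w1 w2 p) * K c u1 u2 w1 w2 O p = 0 := by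
  have hw1 := pdx_hasDeriv h.sw1.diff p
  have hw2 := pdx_hasDeriv h.sw2.diff p
  have hu1 := pdx_hasDeriv h.su1.diff p
  have hu2 := pdx_hasDeriv h.su2.diff p
  have hO := pdx_hasDeriv h.dO p
  have tw1 := pdt_hasDeriv h.sw1.diff p
  have tw2 := pdt_hasDeriv h.sw2.diff p
  have tO := pdt_hasDeriv h.dO p
  have hd := dX_aux (tO.add_const c) (pdt_hasDeriv h.sw1.pdx.diff p) tO
    (pdt_hasDeriv h.su1.diff p) (pdt_hasDeriv h.su2.diff p) tw1 tw1.cj tw2.cj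
    (fun x => h.X1 (p.1, x))
  have hx := dT_aux (hO.add_const c) ((pdx_hasDeriv h.sw1.pdt.diff p).const_mul (-I)) hO
    hu1 hu2 hw1 hw2 hu1.cj hu2.cj hw1.cj hw2.cj
    (pdx_hasDeriv h.su1.pdx.diff p) (pdx_hasDeriv h.su2.pdx.diff p)
    (pdx_hasDeriv h.sw1.pdx.diff p)
    (fun x => h.T1 (x, p.2))
  refine (h.alg p).tcompat (ud2 := -I*pdt u2 p) (h.N1 p) hE (h.M1 p)
    (by rw [h.M2 p]; ring) ?_ hx
  rw [h.sw1.comm p]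
  simp only [map_mul, map_neg, Complex.conj_I]
  linear_combination (-I)*hd

lemma degen (h : BTSol al c u1 u2 w1 w2 O) (p : ℝ × ℝ) (hO : O p = 0)
    (hK1 : K c u1 u2 w1 w2 O p = 0) (hK2 : K c u2 u1 w2 w1 O p = 0) :
    2*u1 p - w1 p = 0 ∧ 2*u2 p - w2 p = 0 := by
  refine (h.alg p).degen hO hK1 ?_
  rw [← hK2]
  unfold K
  rw [add_comm (conj (w1 p) / _ * _)]

lemma pdxO (h : BTSol al c u1 u2 w1 w2 O) (p : ℝ × ℝ) : pdx O p = E u1 u2 w1 w2 p := by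
  have gen : ∀ p, O p ≠ 0 → pdx O p = E u1 u2 w1 w2 p := fun p hp =>
    mul_left_cancel₀ hp (h.dxO p)
  by_cases h0 : O p = 0
  swap
  · exact gen p h0
  by_cases hK1 : K c u1 u2 w1 w2 O p = 0
  swap
  · exact sub_eq_zero.1 ((mul_eq_zero.1 (h.xK p)).resolve_right hK1)
  by_cases hK2 : K c u2 u1 w2 w1 O p = 0
  swap
  · rw [← E_swap]
    exact sub_eq_zero.1 ((mul_eq_zero.1 (h.swap.xK p)).resolve_right hK2)
  obtain ⟨m1, m2⟩ := h.degen p h0 hK1 hK2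
  by_cases hx : pdx O p = 0
  · have e1 : w1 p = 2*u1 p := by linear_combination -m1
    have e2 : w2 p = 2*u2 p := by linear_combination -m2
    rw [hx]
    unfold E EE
    rw [e1, e2]
    simp only [map_mul, map_ofNat]
    ring
  · have hev := (pdx_hasDeriv h.dO p).eventually_ne (c := 0) hx
    refine deriv_eq_of_punctured (f := fun x => O (x, p.2)) (g := fun x => E u1 u2 w1 w2 (x, p.2))
      (f' := fun x => pdx O (x, p.2)) (x0 := p.1) (fun x => pdx_hasDeriv h.dO (x, p.2)) ?_ ?_
    · have := h.smo_E.diff.continuous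
      fun_prop
    · filter_upwards [hev] with x hx
      exact gen _ hx

lemma pdtO_of (h : BTSol al c u1 u2 w1 w2 O) (p : ℝ × ℝ)
    (hp : ¬ (O p = 0 ∧ 2*u1 p - w1 p = 0 ∧ 2*u2 p - w2 p = 0)) :
    -I * pdt O p = P u1 u2 w1 w2 p := by
  by_cases h0 : O p = 0
  swap
  · exact mul_left_cancel₀ h0 (h.dtO p)
  by_cases hK1 : K c u1 u2 w1 w2 O p = 0
  swap
  · exact sub_eq_zero.1 ((mul_eq_zero.1 (h.tK p (h.pdxO p))).resolve_right hK1)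
  by_cases hK2 : K c u2 u1 w2 w1 O p = 0
  swap
  · rw [← P_swap]
    exact sub_eq_zero.1 ((mul_eq_zero.1 (h.swap.tK p (h.swap.pdxO p))).resolve_right hK2)
  exact absurd ⟨h0, h.degen p h0 hK1 hK2⟩ hp

lemma pdtO_of_ne (h : BTSol al c u1 u2 w1 w2 O) (p : ℝ × ℝ)
    (hm : 2*pdx u1 p - pdx w1 p ≠ 0) : -I * pdt O p = P u1 u2 w1 w2 p := by
  have hev := (((pdx_hasDeriv h.su1.diff p).const_mul 2).sub
    (pdx_hasDeriv h.sw1.diff p)).eventually_ne (c := 0) hm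
  have t1 : Tendsto (fun x => -I * pdt O (x, p.2)) (𝓝[≠] p.1) (𝓝 (-I * pdt O p)) :=
    ((pdt_tendsto h.dO h.smo_E h.pdxO p.1 p.2).const_mul (-I)).mono_left nhdsWithin_le_nhds
  have t2 : Tendsto (fun x => P u1 u2 w1 w2 (x, p.2)) (𝓝[≠] p.1) (𝓝 (P u1 u2 w1 w2 p)) := by
    have := h.cont_P
    have h2 : Continuous (fun x => P u1 u2 w1 w2 (x, p.2)) := by fun_prop
    exact (h2.tendsto p.1).mono_left nhdsWithin_le_nhds
  refine tendsto_nhds_unique (t1.congr' ?_) t2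
  filter_upwards [hev] with x hx
  exact h.pdtO_of _ (fun hh => hx hh.2.1)

lemma pdtO (h : BTSol al c u1 u2 w1 w2 O) (p : ℝ × ℝ) :
    -I * pdt O p = P u1 u2 w1 w2 p := by
  by_cases hp : O p = 0 ∧ 2*u1 p - w1 p = 0 ∧ 2*u2 p - w2 p = 0
  swap
  · exact h.pdtO_of p hp
  by_cases hm1 : 2*pdx u1 p - pdx w1 p = 0
  swap
  · exact h.pdtO_of_ne p hm1
  by_cases hm2 : 2*pdx u2 p - pdx w2 p = 0
  swap
  · rw [← P_swap]
    exact h.swap.pdtO_of_ne p hm2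
  obtain ⟨-, m1, m2⟩ := hp
  by_cases hx : pdt O p = 0
  · have e1 : w1 p = 2*u1 p := by linear_combination -m1
    have e2 : w2 p = 2*u2 p := by linear_combination -m2
    have e3 : pdx w1 p = 2*pdx u1 p := by linear_combination -hm1
    have e4 : pdx w2 p = 2*pdx u2 p := by linear_combination -hm2
    rw [hx]
    unfold P PP
    rw [e1, e2, e3, e4]
    simp only [map_mul, map_ofNat]
    ring
  · have hev := (pdt_hasDeriv h.dO p).eventually_ne (c := 0) hx
    refine deriv_eq_of_punctured (f := fun x => -I * O (p.1, x))
      (g := fun x => P u1 u2 w1 w2 (p.1, x))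
      (f' := fun x => -I * pdt O (p.1, x)) (x0 := p.2)
      (fun x => (pdt_hasDeriv h.dO (p.1, x)).const_mul (-I)) ?_ ?_
    · have := h.cont_P
      fun_prop
    · filter_upwards [hev] with x hx
      exact h.pdtO_of _ (fun hh => hx hh.1)

end BTSol

lemma nsq_eq (z : ℂ) : nsq z = z * conj z := by
  unfold nsq; rw [Complex.mul_conj]

lemma pdx_sub' {f g : ℝ × ℝ → ℂ} (hf : Differentiable ℝ f) (hg : Differentiable ℝ g) (p : ℝ × ℝ) :
    pdx (fun q => f q - g q) p = pdx f p - pdx g p :=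
  ((pdx_hasDeriv hf p).sub (pdx_hasDeriv hg p)).deriv

lemma pdt_sub' {f g : ℝ × ℝ → ℂ} (hf : Differentiable ℝ f) (hg : Differentiable ℝ g) (p : ℝ × ℝ) :
    pdt (fun q => f q - g q) p = pdt f p - pdt g p :=
  ((pdt_hasDeriv hf p).sub (pdt_hasDeriv hg p)).deriv

lemma den_eq (b Om : ℝ) : I/3*(Om:ℂ) + I*b = I/3 * ((Om:ℂ) + 3*b) := by ring

lemma B11 (a b : ℝ) (u1 u2 t1 t2 : ℂ) (Om : ℝ) (hs : (Om:ℂ) + 3*b ≠ 0) :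
    ((Om:ℂ) + 3*b) * (3*I*frozenB0 a b u1 u2 t1 t2 Om 1 1)
      = ((Om:ℂ) + 3*b) * (3*I*a + 3*b) - (u1-t1)*(conj u1 - conj t1) := by
  have hI := I_ne_zero
  have h : frozenB0 a b u1 u2 t1 t2 Om 1 1
    = (a:ℂ) - I*b - nsq (I/3*(t1-u1))/(I/3*(Om:ℂ) + I*b) := rfl
  rw [h, den_eq, nsq_eq]
  simp only [map_sub, map_mul, map_div₀, map_ofNat, Complex.conj_I]
  field_simp
  ring_nf
  simp only [I_sq]
  ring

lemma B22 (a b : ℝ) (u1 u2 t1 t2 : ℂ) (Om : ℝ) (hs : (Om:ℂ) + 3*b ≠ 0) :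
    ((Om:ℂ) + 3*b) * (3*I*frozenB0 a b u1 u2 t1 t2 Om 2 2)
      = ((Om:ℂ) + 3*b) * (3*I*a + 3*b) - (u2-t2)*(conj u2 - conj t2) :=
  B11 a b u2 u1 t2 t1 Om hs

lemma B12 (a b : ℝ) (u1 u2 t1 t2 : ℂ) (Om : ℝ) (hs : (Om:ℂ) + 3*b ≠ 0) :
    ((Om:ℂ) + 3*b) * (3*I*frozenB0 a b u1 u2 t1 t2 Om 1 2)
      = - (u2-t2)*(conj u1 - conj t1) := by
  have hI := I_ne_zero
  have h : frozenB0 a b u1 u2 t1 t2 Om 1 2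
    = (-conj (I/3*(t1-u1))) * (I/3*(t2-u2)) / (I/3*(Om:ℂ) + I*b) := rfl
  rw [h, den_eq]
  simp only [map_sub, map_mul, map_div₀, map_ofNat, Complex.conj_I]
  field_simp
  ring_nf
  simp only [I_sq]
  ring

lemma B21 (a b : ℝ) (u1 u2 t1 t2 : ℂ) (Om : ℝ) (hs : (Om:ℂ) + 3*b ≠ 0) :
    ((Om:ℂ) + 3*b) * (3*I*frozenB0 a b u1 u2 t1 t2 Om 2 1)
      = - (u1-t1)*(conj u2 - conj t2) := by
  have h : frozenB0 a b u1 u2 t1 t2 Om 2 1 = - conj (frozenB0 a b u1 u2 t1 t2 Om 1 2) := rfl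
  have h2 := congrArg (starRingEnd ℂ) (B12 a b u1 u2 t1 t2 Om hs)
  rw [h]
  simp only [map_add, map_neg, map_sub, map_mul, map_ofNat, Complex.conj_I, Complex.conj_conj,
    Complex.conj_ofReal] at h2
  linear_combination h2

lemma btsol_of (a b : ℝ) (u1 u2 tu1 tu2 : ℝ × ℝ → ℂ)
    (hu1 : ContDiff ℝ (⊤ : ℕ∞) u1) (hu2 : ContDiff ℝ (⊤ : ℕ∞) u2)
    (htu1 : ContDiff ℝ (⊤ : ℕ∞) tu1) (htu2 : ContDiff ℝ (⊤ : ℕ∞) tu2)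
    (hnls : ∀ p : ℝ × ℝ, CNLSat u1 u2 p) (htnls : ∀ p : ℝ × ℝ, CNLSat tu1 tu2 p)
    (Om : ℝ × ℝ → ℝ) (hOm : Differentiable ℝ Om)
    (hOm2 : ∀ p : ℝ × ℝ, (Om p)^2
      = 9*b^2 - Complex.normSq (u1 p - tu1 p) - Complex.normSq (u2 p - tu2 p))
    (hOm3b : ∀ p : ℝ × ℝ, Om p + 3*b ≠ 0)
    (hBT : ∀ p : ℝ × ℝ,
      BTspaceAt a u1 u2 tu1 tu2
        (frozenB0 a b (u1 p) (u2 p) (tu1 p) (tu2 p) (Om p)) (Om p) p ∧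
      BTtimeAt a u1 u2 tu1 tu2
        (frozenB0 a b (u1 p) (u2 p) (tu1 p) (tu2 p) (Om p)) (Om p) p) :
    BTSol (3*I*a) (3*b) u1 u2 (fun q => u1 q - tu1 q) (fun q => u2 q - tu2 q)
      (fun q => (Om q : ℂ)) := by
  have hs : ∀ p, (Om p : ℂ) + 3*b ≠ 0 := fun p => by exact_mod_cast hOm3b p
  have sw1 : Smo (fun q => u1 q - tu1 q) := ContDiff.sub hu1 htu1
  have sw2 : Smo (fun q => u2 q - tu2 q) := ContDiff.sub hu2 htu2
  have s1 : Smo u1 := hu1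
  have s2 : Smo u2 := hu2
  have s3 : Smo tu1 := htu1
  have s4 : Smo tu2 := htu2
  have f1 : pdx (fun q => u1 q - tu1 q) = fun q => pdx u1 q - pdx tu1 q :=
    funext (pdx_sub' s1.diff s3.diff)
  have f2 : pdx (fun q => u2 q - tu2 q) = fun q => pdx u2 q - pdx tu2 q :=
    funext (pdx_sub' s2.diff s4.diff)
  have g1 := pdt_sub' s1.diff s3.diff
  have g2 := pdt_sub' s2.diff s4.diff
  have e11 := fun p => B11 a b (u1 p) (u2 p) (tu1 p) (tu2 p) (Om p) (hs p)
  have e22 := fun p => B22 a b (u1 p) (u2 p) (tu1 p) (tu2 p) (Om p) (hs p)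
  have e12 := fun p => B12 a b (u1 p) (u2 p) (tu1 p) (tu2 p) (Om p) (hs p)
  have e21 := fun p => B21 a b (u1 p) (u2 p) (tu1 p) (tu2 p) (Om p) (hs p)
  have rel : ∀ p, (Om p : ℂ)^2 = (3*b)^2 - (u1 p - tu1 p)*conj (u1 p - tu1 p)
      - (u2 p - tu2 p)*conj (u2 p - tu2 p) := by
    intro p
    rw [Complex.mul_conj, Complex.mul_conj]
    have := congrArg (fun x : ℝ => (x : ℂ)) (hOm2 p)
    push_cast at this
    linear_combination this
  refine ⟨hu1, hu2, sw1, sw2, ?_, ?_, ?_, ?_, hs, rel, ?_, ?_, ?_, ?_, ?_, ?_, ?_, ?_⟩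
  · exact Complex.ofRealCLM.differentiable.comp hOm
  · simp only [map_mul, map_ofNat, Complex.conj_I, Complex.conj_ofReal]; ring
  · simp only [map_mul, map_ofNat, Complex.conj_ofReal]
  · intro p; exact Complex.conj_ofReal _
  · intro p
    have h := (hBT p).1.1
    have r := rel p
    rw [h]
    simp only [map_sub] at r ⊢
    linear_combination u1 p * e11 p + u2 p * e21 p
  · intro p
    have h := (hBT p).1.2
    have r := rel p
    rw [h]
    simp only [map_sub] at r ⊢
    linear_combination u1 p * e12 p + u2 p * e22 p
  · intro p
    have h := (hBT p).2.1
    rw [h]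
    simp only [f1, map_sub, nsq_eq]
    have q1 := e11 p
    have q2 := e21 p
    generalize frozenB0 a b (u1 p) (u2 p) (tu1 p) (tu2 p) (Om p) = B at *
    have i2 := I_sq
    linear_combination pdx u1 p * q1 + pdx u2 p * q2 - ((Om p : ℂ)+3*b) *
      ((u1 p - tu1 p)*(u1 p * conj (u1 p) + u2 p * conj (u2 p) + tu1 p * conj (tu1 p)
        + tu2 p * conj (tu2 p)) + (tu1 p*u2 p - u1 p*tu2 p)*conj (tu2 p)
        + pdx tu1 p*((Om p:ℂ) - 3*I*a)) * i2
  · intro p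
    have h := (hBT p).2.2
    rw [h]
    simp only [f2, map_sub, nsq_eq]
    have q1 := e12 p
    have q2 := e22 p
    generalize frozenB0 a b (u1 p) (u2 p) (tu1 p) (tu2 p) (Om p) = B at *
    have i2 := I_sq
    linear_combination pdx u1 p * q1 + pdx u2 p * q2 - ((Om p : ℂ)+3*b) *
      ((u2 p - tu2 p)*(u1 p * conj (u1 p) + u2 p * conj (u2 p) + tu1 p * conj (tu1 p)
        + tu2 p * conj (tu2 p)) + (u1 p*tu2 p - tu1 p*u2 p)*conj (tu1 p)
        + pdx tu2 p*((Om p:ℂ) - 3*I*a)) * i2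
  · intro p
    have h1 := (hnls p).1
    have h2 := (htnls p).1
    rw [f1, pdx_sub' s1.pdx.diff s3.pdx.diff, g1]
    simp only [map_sub, nsq_eq] at *
    linear_combination h1 - h2
  · intro p
    have h1 := (hnls p).2
    have h2 := (htnls p).2
    rw [f2, pdx_sub' s2.pdx.diff s4.pdx.diff, g2]
    simp only [map_sub, nsq_eq] at *
    linear_combination h1 - h2
  · intro p
    have h1 := (hnls p).1
    simp only [nsq_eq] at *
    linear_combination -h1
  · intro p
    have h1 := (hnls p).2
    simp only [nsq_eq] at *
    linear_combination -h1

/-- the BT relates the time Hamiltonian densities by a total t-derivative. -/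
theorem stmt6 (a b : ℝ) (u1 u2 tu1 tu2 : ℝ × ℝ → ℂ)
    (hu1 : ContDiff ℝ (⊤ : ℕ∞) u1) (hu2 : ContDiff ℝ (⊤ : ℕ∞) u2)
    (htu1 : ContDiff ℝ (⊤ : ℕ∞) tu1) (htu2 : ContDiff ℝ (⊤ : ℕ∞) tu2)
    (hnls : ∀ p : ℝ × ℝ, CNLSat u1 u2 p) (htnls : ∀ p : ℝ × ℝ, CNLSat tu1 tu2 p)
    (Om : ℝ × ℝ → ℝ) (hOm : Differentiable ℝ Om)
    (hOm2 : ∀ p : ℝ × ℝ, (Om p)^2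
      = 9*b^2 - Complex.normSq (u1 p - tu1 p) - Complex.normSq (u2 p - tu2 p))
    (hOm3b : ∀ p : ℝ × ℝ, Om p + 3*b ≠ 0)
    (hBT : ∀ p : ℝ × ℝ,
      BTspaceAt a u1 u2 tu1 tu2
        (frozenB0 a b (u1 p) (u2 p) (tu1 p) (tu2 p) (Om p)) (Om p) p ∧
      BTtimeAt a u1 u2 tu1 tu2
        (frozenB0 a b (u1 p) (u2 p) (tu1 p) (tu2 p) (Om p)) (Om p) p) :
    ∀ p : ℝ × ℝ,
      (I/2 * (conj (u1 p) * pdt u1 p - u1 p * pdt (fun q => conj (u1 q)) p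
          + conj (u2 p) * pdt u2 p - u2 p * pdt (fun q => conj (u2 q)) p)
        + nsq (pdx u1 p) + nsq (pdx u2 p) + (nsq (u1 p) + nsq (u2 p))^2)
      - (I/2 * (conj (tu1 p) * pdt tu1 p - tu1 p * pdt (fun q => conj (tu1 q)) p
          + conj (tu2 p) * pdt tu2 p - tu2 p * pdt (fun q => conj (tu2 q)) p)
        + nsq (pdx tu1 p) + nsq (pdx tu2 p) + (nsq (tu1 p) + nsq (tu2 p))^2)
      = pdt (fun q =>
          I/2 * (conj (u1 q) * tu1 q - u1 q * conj (tu1 q)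
            + conj (u2 q) * tu2 q - u2 q * conj (tu2 q) - 6*I*(a:ℂ)*(Om q : ℂ))) p := by
  have hsol := btsol_of a b u1 u2 tu1 tu2 hu1 hu2 htu1 htu2 hnls htnls Om hOm hOm2 hOm3b hBT
  intro p
  have hP := hsol.pdtO p
  have hF := (hsol.alg p).final
  have du1 := pdt_hasDeriv (Smo.diff hu1) p
  have du2 := pdt_hasDeriv (Smo.diff hu2) p
  have dt1 := pdt_hasDeriv (Smo.diff htu1) p
  have dt2 := pdt_hasDeriv (Smo.diff htu2) p
  have dO := pdt_hasDeriv hsol.dO p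
  have hR := ((((((du1.cj.mul dt1).sub (du1.mul dt1.cj)).add (du2.cj.mul dt2)).sub
    (du2.mul dt2.cj)).sub (dO.const_mul (6*I*(a:ℂ)))).const_mul (I/2)).deriv
  have hR' : pdt (fun q =>
          I/2 * (conj (u1 q) * tu1 q - u1 q * conj (tu1 q)
            + conj (u2 q) * tu2 q - u2 q * conj (tu2 q) - 6*I*(a:ℂ)*(Om q : ℂ))) p = _ := hR
  rw [hR']
  unfold BTSol.P at hP
  rw [← hP] at hF
  rw [pdt_conj (Smo.diff hu1), pdt_conj (Smo.diff hu2), pdt_conj (Smo.diff htu1),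
    pdt_conj (Smo.diff htu2)]
  rw [pdx_sub' (Smo.diff hu1) (Smo.diff htu1), pdx_sub' (Smo.diff hu2) (Smo.diff htu2),
    pdt_sub' (Smo.diff hu1) (Smo.diff htu1), pdt_sub' (Smo.diff hu2) (Smo.diff htu2)] at hF
  simp only [map_sub, map_mul, map_neg, Complex.conj_I] at hF
  simp only [nsq_eq]
  linear_combination hF
end
end

section
/- (First conserved quantity of the defect system.) Let a, b ∈ ℝ. Suppose u1,u2 are smooth on [0,∞)×ℝ and solve the coupled NLS equation, and ũ1,ũ2 are smooth on (−∞,0]×ℝ and solve it. Suppose Ω : ℝ → ℝ is differentiable with Ω(t)² = 9b² − |u1(0,t)−ũ1(0,t)|² − |u2(0,t)−ũ2(0,t)|², Ω(t) ≠ 0 and Ω(t)+3b ≠ 0 for all t, and the four BT equations hold at x = 0 (with ∂x the one-sided spatial derivatives at 0, ∂t the time derivative of the boundary values, and B⁰ formed from the boundary values and Ω). Assume for each t: x ↦ |u1|²+|u2|² is integrable on [0,∞), x ↦ |ũ1|²+|ũ2|² is integrable on (−∞,0], both integrals are differentiable in t with derivative obtained by differentiating under the integral sign, the flux G := i(conj(u1)·∂x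 u1 − u1·∂x conj(u1) + conj(u2)·∂x u2 − u2·∂x conj(u2)) satisfies G(x,t) → 0 as x → +∞ with x ↦ ∂x G integrable on [0,∞), and the analogous tilde flux G̃ satisfies G̃(x,t) → 0 as x → −∞ with x ↦ ∂x G̃ integrable on (−∞,0]. Then the function t ↦ ∫_{−∞}^0(|ũ1|²+|ũ2|²)dx + ∫_0^∞(|u1|²+|u2|²)dx − Ω(t) is constant. -/
open Complex MeasureTheory Filter Topology ComplexConjugate Matrix

noncomputable section

lemma HasDerivAt.cconj {f : ℝ → ℂ} {f' : ℂ} {x : ℝ} (h : HasDerivAt f f' x) :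
    HasDerivAt (fun y => conj (f y)) (conj f') x := by
  simpa using h.star

lemma hasDerivAt_pdx {u : ℝ × ℝ → ℂ} (hu : ContDiff ℝ (⊤ : ℕ∞) u) (x t : ℝ) :
    HasDerivAt (fun y => u (y, t)) (pdx u (x, t)) x := by
  have h : ContDiff ℝ (⊤ : ℕ∞) (fun y : ℝ => u (y, t)) :=
    hu.comp (contDiff_id.prodMk contDiff_const)
  exact (h.differentiable (by simp) x).hasDerivAt

lemma hasDerivAt_pdt {u : ℝ × ℝ → ℂ} (hu : ContDiff ℝ (⊤ : ℕ∞) u) (x t : ℝ) :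
    HasDerivAt (fun s => u (x, s)) (pdt u (x, t)) t := by
  have h : ContDiff ℝ (⊤ : ℕ∞) (fun y : ℝ => u (x, y)) :=
    hu.comp (contDiff_const.prodMk contDiff_id)
  exact (h.differentiable (by simp) t).hasDerivAt

lemma hasDerivAt_pdxx {u : ℝ × ℝ → ℂ} (hu : ContDiff ℝ (⊤ : ℕ∞) u) (x t : ℝ) :
    HasDerivAt (fun y => pdx u (y, t)) (pdx (pdx u) (x, t)) x := by
  have h : ContDiff ℝ (⊤ : ℕ∞) (fun y : ℝ => u (y, t)) :=
    hu.comp (contDiff_id.prodMk contDiff_const)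
  have h2 : Differentiable ℝ (deriv (fun y : ℝ => u (y, t))) :=
    (contDiff_infty_iff_deriv.mp h).2.differentiable (by simp)
  exact (h2 x).hasDerivAt

lemma pdx_conj_s9 {u : ℝ × ℝ → ℂ} (hu : ContDiff ℝ (⊤ : ℕ∞) u) (x t : ℝ) :
    pdx (fun r => conj (u r)) (x, t) = conj (pdx u (x, t)) :=
  (hasDerivAt_pdx hu x t).cconj.deriv

lemma hasDerivAt_nsq {f : ℝ → ℂ} {f' : ℂ} {x : ℝ} (h : HasDerivAt f f' x) :
    HasDerivAt (fun y => Complex.normSq (f y)) (2 * (conj (f x) * f').re) x := by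
  have e : (fun y => Complex.normSq (f y)) = fun y => (conj (f y) * f y).re := by
    funext y
    rw [mul_comm, mul_conj, ofReal_re]
  rw [e]
  have := Complex.reCLM.hasFDerivAt.comp_hasDerivAt x (h.cconj.mul h)
  refine this.congr_deriv ?_
  simp
  ring

lemma re_double_cast (z : ℂ) : ((2 * z.re : ℝ) : ℂ) = z + conj z := by
  rw [add_conj]

/-- x-derivative of the flux. -/
lemma flux_deriv {u1 u2 G : ℝ × ℝ → ℂ}
    (hu1 : ContDiff ℝ (⊤ : ℕ∞) u1) (hu2 : ContDiff ℝ (⊤ : ℕ∞) u2)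
    (hG : ∀ q, G q = I * (conj (u1 q) * pdx u1 q - u1 q * pdx (fun r => conj (u1 r)) q
      + conj (u2 q) * pdx u2 q - u2 q * pdx (fun r => conj (u2 r)) q)) (x t : ℝ) :
    HasDerivAt (fun y => G (y, t)) (I * (conj (u1 (x, t)) * pdx (pdx u1) (x, t)
      - u1 (x, t) * conj (pdx (pdx u1) (x, t))
      + conj (u2 (x, t)) * pdx (pdx u2) (x, t) - u2 (x, t) * conj (pdx (pdx u2) (x, t)))) x := by
  have e : (fun y => G (y, t)) = fun y => I * (conj (u1 (y, t)) * pdx u1 (y, t)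
      - u1 (y, t) * conj (pdx u1 (y, t))
      + conj (u2 (y, t)) * pdx u2 (y, t) - u2 (y, t) * conj (pdx u2 (y, t))) := by
    funext y
    rw [hG, pdx_conj_s9 hu1, pdx_conj_s9 hu2]
  rw [e]
  have a1 := hasDerivAt_pdx hu1 x t
  have a2 := hasDerivAt_pdx hu2 x t
  have b1 := hasDerivAt_pdxx hu1 x t
  have b2 := hasDerivAt_pdxx hu2 x t
  refine ((((a1.cconj.mul b1).sub (a1.mul b1.cconj)).add (a2.cconj.mul b2)).sub
    (a2.mul b2.cconj)).const_mul I |>.congr_deriv ?_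
  ring

lemma flux_eq {u1 u2 G : ℝ × ℝ → ℂ}
    (hu1 : ContDiff ℝ (⊤ : ℕ∞) u1) (hu2 : ContDiff ℝ (⊤ : ℕ∞) u2)
    (hG : ∀ q, G q = I * (conj (u1 q) * pdx u1 q - u1 q * pdx (fun r => conj (u1 r)) q
      + conj (u2 q) * pdx u2 q - u2 q * pdx (fun r => conj (u2 r)) q)) (x t : ℝ)
    (h : CNLSat u1 u2 (x, t)) :
    ((deriv (fun s => Complex.normSq (u1 (x, s)) + Complex.normSq (u2 (x, s))) t : ℝ) : ℂ)
      = pdx G (x, t) := by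
  have hd : deriv (fun s => Complex.normSq (u1 (x, s)) + Complex.normSq (u2 (x, s))) t = _ :=
    ((hasDerivAt_nsq (hasDerivAt_pdt hu1 x t)).add
      (hasDerivAt_nsq (hasDerivAt_pdt hu2 x t))).deriv
  rw [hd]
  rw [show pdx G (x, t) = _ from (flux_deriv hu1 hu2 hG x t).deriv]
  obtain ⟨h1, h2⟩ := h
  have c1 := congrArg conj h1
  have c2 := congrArg conj h2
  simp only [nsq, map_add, map_mul, conj_I, conj_ofReal, map_zero, map_ofNat] at h1 h2 c1 c2
  rw [ofReal_add, re_double_cast, re_double_cast]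
  simp only [map_mul, conj_conj]
  generalize u1 (x, t) = U1 at *
  generalize u2 (x, t) = U2 at *
  have I2 : I * I = -1 := I_mul_I
  linear_combination (-I * conj U1) * h1 + (-I * conj U2) * h2 + (I * U1) * c1 + (I * U2) * c2
    + (conj U1 * pdt u1 (x, t) + conj U2 * pdt u2 (x, t) + U1 * conj (pdt u1 (x, t)) + U2 * conj (pdt u2 (x, t))) * I2

lemma B0_entries (a b : ℝ) (u1 u2 tu1 tu2 : ℂ) (Om : ℝ) (h : Om + 3 * b ≠ 0) :
    let B := frozenB0 a b u1 u2 tu1 tu2 Om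
    let k : ℂ := ((Om + 3 * b)⁻¹ : ℝ)
    3 * I * B 1 1 = 3 * I * a + 3 * b - k * ((u1 - tu1) * conj (u1 - tu1)) ∧
    3 * I * B 2 1 = - k * ((u1 - tu1) * conj (u2 - tu2)) ∧
    3 * I * B 1 2 = - k * (conj (u1 - tu1) * (u2 - tu2)) ∧
    3 * I * B 2 2 = 3 * I * a + 3 * b - k * ((u2 - tu2) * conj (u2 - tu2)) := by
  intro B k
  have hK : ((Om : ℂ) + 3 * b) ≠ 0 := by exact_mod_cast h
  have hd : I / 3 * (Om : ℂ) + I * b = I / 3 * ((Om : ℂ) + 3 * b) := by ring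
  have hk : k = ((Om : ℂ) + 3 * b)⁻¹ := by simp [k]
  have hI : I ≠ 0 := I_ne_zero
  have I2 : I ^ 2 = -1 := I_sq
  have h3 : conj (3 : ℂ) = 3 := map_ofNat _ 3
  simp only [B, frozenB0, nsq, hd, ← mul_conj, hk]
  simp [h3]
  refine ⟨?_, ?_, ?_, ?_⟩ <;> field_simp <;> ring_nf <;> simp [I2] <;> ring_nf

/-- The boundary algebra: `w_j` jump, `v_j` x-derivative of `u_j`, `y_j` x-derivative of the jump,
`z_j` t-derivative of the jump; capital letters are conjugates. -/
lemma boundary_algebra (a b Om k j u1 u2 w1 w2 v1 v2 y1 y2 z1 z2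
    U1 U2 W1 W2 V1 V2 Y1 Y2 Z1 Z2 d : ℂ)
    (j2 : j * j = -1)
    (hR : k * (w1 * W1 + w2 * W2) = 3 * b - Om)
    (hy1 : y1 = (u1 - w1) * (Om - 3 * j * a) + u1 * (3 * j * a + 3 * b - k * (w1 * W1))
      + u2 * (- k * (w1 * W2)))
    (hy2 : y2 = (u2 - w2) * (Om - 3 * j * a) + u1 * (- k * (W1 * w2))
      + u2 * (3 * j * a + 3 * b - k * (w2 * W2)))
    (hY1 : Y1 = (U1 - W1) * (Om + 3 * j * a) + U1 * (- 3 * j * a + 3 * b - k * (W1 * w1))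
      + U2 * (- k * (W1 * w2)))
    (hY2 : Y2 = (U2 - W2) * (Om + 3 * j * a) + U1 * (- k * (w1 * W2))
      + U2 * (- 3 * j * a + 3 * b - k * (W2 * w2)))
    (hz1 : z1 = j * w1 * d + j * ((u1 - w1) * u2 - u1 * (u2 - w2)) * (U2 - W2)
      + j * (v1 - y1) * (Om - 3 * j * a) + j * v1 * (3 * j * a + 3 * b - k * (w1 * W1))
      + j * v2 * (- k * (w1 * W2)))
    (hz2 : z2 = j * w2 * d + j * (u1 * (u2 - w2) - (u1 - w1) * u2) * (U1 - W1)
      + j * (v2 - y2) * (Om - 3 * j * a) + j * v1 * (- k * (W1 * w2))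
      + j * v2 * (3 * j * a + 3 * b - k * (w2 * W2)))
    (hZ1 : Z1 = - j * W1 * d - j * ((U1 - W1) * U2 - U1 * (U2 - W2)) * (u2 - w2)
      - j * (V1 - Y1) * (Om + 3 * j * a) - j * V1 * (- 3 * j * a + 3 * b - k * (W1 * w1))
      - j * V2 * (- k * (W1 * w2)))
    (hZ2 : Z2 = - j * W2 * d - j * (U1 * (U2 - W2) - (U1 - W1) * U2) * (u1 - w1)
      - j * (V2 - Y2) * (Om + 3 * j * a) - j * V1 * (- k * (w1 * W2))
      - j * V2 * (- 3 * j * a + 3 * b - k * (W2 * w2))) :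
    2 * Om * (j * ((U1 - W1) * (v1 - y1) - (u1 - w1) * (V1 - Y1)
        + (U2 - W2) * (v2 - y2) - (u2 - w2) * (V2 - Y2))
      - j * (U1 * v1 - u1 * V1 + U2 * v2 - u2 * V2))
      = - (W1 * z1 + w1 * Z1 + W2 * z2 + w2 * Z2) := by
  have hA : W1 * z1 + W2 * z2 = j * d * (w1 * W1 + w2 * W2)
      - j * (u1 * w2 - w1 * u2) * (U1 * W2 - W1 * U2)
      + j * Om * (2 * (W1 * v1 + W2 * v2) - (W1 * y1 + W2 * y2)) - 3 * a * (W1 * y1 + W2 * y2) := by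
    rw [hz1, hz2]
    linear_combination (-j * (W1 * v1 + W2 * v2)) * hR + 3 * a * (W1 * y1 + W2 * y2) * j2
  have hB : w1 * Z1 + w2 * Z2 = - j * d * (w1 * W1 + w2 * W2)
      + j * (u1 * w2 - w1 * u2) * (U1 * W2 - W1 * U2)
      - j * Om * (2 * (w1 * V1 + w2 * V2) - (w1 * Y1 + w2 * Y2)) - 3 * a * (w1 * Y1 + w2 * Y2) := by
    rw [hZ1, hZ2]
    linear_combination (j * (w1 * V1 + w2 * V2)) * hR + 3 * a * (w1 * Y1 + w2 * Y2) * j2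
  have hWy : W1 * y1 + W2 * y2 = (w1 * W1 + w2 * W2) * (3 * j * a - Om)
      + 2 * Om * (u1 * W1 + u2 * W2) := by
    rw [hy1, hy2]
    linear_combination (-(u1 * W1 + u2 * W2)) * hR
  have hwY : w1 * Y1 + w2 * Y2 = (w1 * W1 + w2 * W2) * (-3 * j * a - Om)
      + 2 * Om * (U1 * w1 + U2 * w2) := by
    rw [hY1, hY2]
    linear_combination (-(U1 * w1 + U2 * w2)) * hR
  have hUy : U1 * y1 + U2 * y2 - (u1 * Y1 + u2 * Y2)
      = 3 * j * a * (u1 * W1 + u2 * W2 + (U1 * w1 + U2 * w2))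
        - Om * (U1 * w1 + U2 * w2 - (u1 * W1 + u2 * W2)) := by
    rw [hy1, hy2, hY1, hY2]
    ring
  linear_combination hA + hB - 2 * Om * j * hUy + (j * Om - 3 * a) * hWy
    + (-j * Om - 3 * a) * hwY + 6 * a * Om * (w1 * W1 + w2 * W2 - (u1 * W1 + u2 * W2)
      - (U1 * w1 + U2 * w2)) * j2

/-- the first conserved quantity (modified norm) of the defect system. -/
theorem stmt9 (a b : ℝ) (u1 u2 tu1 tu2 : ℝ × ℝ → ℂ)
    (hu1 : ContDiff ℝ (⊤ : ℕ∞) u1) (hu2 : ContDiff ℝ (⊤ : ℕ∞) u2)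
    (htu1 : ContDiff ℝ (⊤ : ℕ∞) tu1) (htu2 : ContDiff ℝ (⊤ : ℕ∞) tu2)
    (hnls : ∀ p : ℝ × ℝ, 0 ≤ p.1 → CNLSat u1 u2 p)
    (htnls : ∀ p : ℝ × ℝ, p.1 ≤ 0 → CNLSat tu1 tu2 p)
    (Om : ℝ → ℝ) (hOm : Differentiable ℝ Om)
    (hOm2 : ∀ t, (Om t)^2 = 9*b^2 - Complex.normSq (u1 (0, t) - tu1 (0, t))
      - Complex.normSq (u2 (0, t) - tu2 (0, t)))
    (hOmne : ∀ t, Om t ≠ 0) (hOm3b : ∀ t, Om t + 3*b ≠ 0)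
    (hBT : ∀ t : ℝ,
      BTspaceAt a u1 u2 tu1 tu2
        (frozenB0 a b (u1 (0, t)) (u2 (0, t)) (tu1 (0, t)) (tu2 (0, t)) (Om t)) (Om t) (0, t) ∧
      BTtimeAt a u1 u2 tu1 tu2
        (frozenB0 a b (u1 (0, t)) (u2 (0, t)) (tu1 (0, t)) (tu2 (0, t)) (Om t)) (Om t) (0, t))
    (hint : ∀ t, IntegrableOn
      (fun x => Complex.normSq (u1 (x, t)) + Complex.normSq (u2 (x, t))) (Set.Ici 0))
    (htint : ∀ t, IntegrableOn
      (fun x => Complex.normSq (tu1 (x, t)) + Complex.normSq (tu2 (x, t))) (Set.Iic 0))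
    (hder : ∀ t, HasDerivAt
      (fun s => ∫ x in Set.Ici (0:ℝ), (Complex.normSq (u1 (x, s)) + Complex.normSq (u2 (x, s))))
      (∫ x in Set.Ici (0:ℝ),
        deriv (fun s => Complex.normSq (u1 (x, s)) + Complex.normSq (u2 (x, s))) t) t)
    (htder : ∀ t, HasDerivAt
      (fun s => ∫ x in Set.Iic (0:ℝ), (Complex.normSq (tu1 (x, s)) + Complex.normSq (tu2 (x, s))))
      (∫ x in Set.Iic (0:ℝ),
        deriv (fun s => Complex.normSq (tu1 (x, s)) + Complex.normSq (tu2 (x, s))) t) t)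
    (G tG : ℝ × ℝ → ℂ)
    (hG : ∀ q, G q = I * (conj (u1 q) * pdx u1 q - u1 q * pdx (fun r => conj (u1 r)) q
      + conj (u2 q) * pdx u2 q - u2 q * pdx (fun r => conj (u2 r)) q))
    (htG : ∀ q, tG q = I * (conj (tu1 q) * pdx tu1 q - tu1 q * pdx (fun r => conj (tu1 r)) q
      + conj (tu2 q) * pdx tu2 q - tu2 q * pdx (fun r => conj (tu2 r)) q))
    (hGlim : ∀ t, Tendsto (fun x => G (x, t)) atTop (nhds 0))
    (hGint : ∀ t, IntegrableOn (fun x => pdx G (x, t)) (Set.Ici 0))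
    (htGlim : ∀ t, Tendsto (fun x => tG (x, t)) atBot (nhds 0))
    (htGint : ∀ t, IntegrableOn (fun x => pdx tG (x, t)) (Set.Iic 0)) :
    ∀ t s : ℝ,
      ((∫ x in Set.Iic (0:ℝ), (Complex.normSq (tu1 (x, t)) + Complex.normSq (tu2 (x, t))))
        + (∫ x in Set.Ici (0:ℝ), (Complex.normSq (u1 (x, t)) + Complex.normSq (u2 (x, t))))
        - Om t)
      = ((∫ x in Set.Iic (0:ℝ), (Complex.normSq (tu1 (x, s)) + Complex.normSq (tu2 (x, s))))
        + (∫ x in Set.Ici (0:ℝ), (Complex.normSq (u1 (x, s)) + Complex.normSq (u2 (x, s))))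
        - Om s) := by
  have key : ∀ t, HasDerivAt (fun t =>
      ((∫ x in Set.Iic (0:ℝ), (Complex.normSq (tu1 (x, t)) + Complex.normSq (tu2 (x, t))))
        + (∫ x in Set.Ici (0:ℝ), (Complex.normSq (u1 (x, t)) + Complex.normSq (u2 (x, t))))
        - Om t)) 0 t := by
    intro t
    have hd := ((htder t).add (hder t)).sub (hOm t).hasDerivAt
    refine hd.congr_deriv ?_
    have e1 : (((∫ x in Set.Ici (0:ℝ),
        deriv (fun s => Complex.normSq (u1 (x, s)) + Complex.normSq (u2 (x, s))) t) : ℝ) : ℂ)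
        = - G (0, t) := by
      rw [← integral_complex_ofReal]
      rw [setIntegral_congr_fun measurableSet_Ici
        (fun x hx => flux_eq hu1 hu2 hG x t (hnls (x, t) hx))]
      rw [integral_Ici_eq_integral_Ioi]
      exact (integral_Ioi_of_hasDerivAt_of_tendsto' (f := fun x => G (x, t)) (m := 0)
          (fun x _ => (flux_deriv hu1 hu2 hG x t).differentiableAt.hasDerivAt)
          ((hGint t).mono_set Set.Ioi_subset_Ici_self) (hGlim t)).trans (by simp)
    have e2 : (((∫ x in Set.Iic (0:ℝ),
        deriv (fun s => Complex.normSq (tu1 (x, s)) + Complex.normSq (tu2 (x, s))) t) : ℝ) : ℂ)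
        = tG (0, t) := by
      rw [← integral_complex_ofReal]
      rw [setIntegral_congr_fun measurableSet_Iic
        (fun x hx => flux_eq htu1 htu2 htG x t (htnls (x, t) hx))]
      exact (integral_Iic_of_hasDerivAt_of_tendsto' (f := fun x => tG (x, t)) (m := 0)
          (fun x _ => (flux_deriv htu1 htu2 htG x t).differentiableAt.hasDerivAt)
          (htGint t) (htGlim t)).trans (by simp)
    have hx1 : pdx (fun q => u1 q - tu1 q) (0, t) = pdx u1 (0, t) - pdx tu1 (0, t) :=
      ((hasDerivAt_pdx hu1 0 t).sub (hasDerivAt_pdx htu1 0 t)).deriv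
    have hx2 : pdx (fun q => u2 q - tu2 q) (0, t) = pdx u2 (0, t) - pdx tu2 (0, t) :=
      ((hasDerivAt_pdx hu2 0 t).sub (hasDerivAt_pdx htu2 0 t)).deriv
    have ht1 : HasDerivAt (fun s => u1 (0, s) - tu1 (0, s))
        (pdt (fun q => u1 q - tu1 q) (0, t)) t :=
      ((hasDerivAt_pdt hu1 0 t).sub (hasDerivAt_pdt htu1 0 t)).differentiableAt.hasDerivAt
    have ht2 : HasDerivAt (fun s => u2 (0, s) - tu2 (0, s))
        (pdt (fun q => u2 q - tu2 q) (0, t)) t :=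
      ((hasDerivAt_pdt hu2 0 t).sub (hasDerivAt_pdt htu2 0 t)).differentiableAt.hasDerivAt
    have hOd : 2 * Om t * deriv Om t
        = - (2 * (conj (u1 (0, t) - tu1 (0, t)) * pdt (fun q => u1 q - tu1 q) (0, t)).re)
          - 2 * (conj (u2 (0, t) - tu2 (0, t)) * pdt (fun q => u2 q - tu2 q) (0, t)).re := by
      have A := (hOm t).hasDerivAt.pow 2
      have B := ((hasDerivAt_nsq ht1).const_sub (9 * b ^ 2)).sub (hasDerivAt_nsq ht2)
      have e : Om ^ 2 = (fun x => 9 * b ^ 2 - normSq (u1 (0, x) - tu1 (0, x)))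
          - fun y => normSq (u2 (0, y) - tu2 (0, y)) := by
        funext s
        simpa using hOm2 s
      rw [e] at A
      have := A.unique B
      simpa using this
    have hOdC : 2 * (Om t : ℂ) * (deriv Om t : ℝ)
        = - (conj (u1 (0, t) - tu1 (0, t)) * pdt (fun q => u1 q - tu1 q) (0, t)
          + (u1 (0, t) - tu1 (0, t)) * conj (pdt (fun q => u1 q - tu1 q) (0, t))
          + conj (u2 (0, t) - tu2 (0, t)) * pdt (fun q => u2 q - tu2 q) (0, t)
          + (u2 (0, t) - tu2 (0, t)) * conj (pdt (fun q => u2 q - tu2 q) (0, t))) := by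
      have := congrArg (fun r : ℝ => (r : ℂ)) hOd
      simp only [ofReal_sub, ofReal_neg, re_double_cast] at this
      simp only [map_mul, conj_conj] at this
      push_cast at this
      rw [this]
      ring
    obtain ⟨⟨s1, s2⟩, ⟨q1, q2⟩⟩ := hBT t
    obtain ⟨B11, B21, B12, B22⟩ := B0_entries a b (u1 (0, t)) (u2 (0, t)) (tu1 (0, t))
      (tu2 (0, t)) (Om t) (hOm3b t)
    have hR : (((Om t + 3 * b)⁻¹ : ℝ) : ℂ) * ((u1 (0, t) - tu1 (0, t)) * conj (u1 (0, t) - tu1 (0, t))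
        + (u2 (0, t) - tu2 (0, t)) * conj (u2 (0, t) - tu2 (0, t))) = 3 * (b : ℂ) - (Om t : ℂ) := by
      rw [mul_conj, mul_conj]
      have : (Om t + 3 * b)⁻¹ * (normSq (u1 (0, t) - tu1 (0, t))
          + normSq (u2 (0, t) - tu2 (0, t))) = 3 * b - Om t := by
        rw [inv_mul_eq_iff_eq_mul₀ (hOm3b t)]
        linear_combination hOm2 t
      exact_mod_cast this
    have hg := hG (0, t)
    have htg := htG (0, t)
    rw [pdx_conj_s9 hu1, pdx_conj_s9 hu2] at hg
    rw [pdx_conj_s9 htu1, pdx_conj_s9 htu2] at htg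
    have hOC : (Om t : ℂ) ≠ 0 := by exact_mod_cast hOmne t
    have fin : tG (0, t) - G (0, t) = ((deriv Om t : ℝ) : ℂ) := by
      apply mul_left_cancel₀ (mul_ne_zero two_ne_zero hOC)
      rw [hOdC, hg, htg]
      rw [hx1] at s1
      rw [hx2] at s2
      generalize frozenB0 a b (u1 (0, t)) (u2 (0, t)) (tu1 (0, t)) (tu2 (0, t)) (Om t) = B at *
      generalize (Om t + 3 * b)⁻¹ = k at *
      generalize pdt (fun q => u1 q - tu1 q) (0, t) = z1 at *
      generalize pdt (fun q => u2 q - tu2 q) (0, t) = z2 at *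
      generalize pdx u1 (0, t) = v1 at *
      generalize pdx u2 (0, t) = v2 at *
      generalize pdx tu1 (0, t) = tv1 at *
      generalize pdx tu2 (0, t) = tv2 at *
      generalize u1 (0, t) = p1 at *
      generalize u2 (0, t) = p2 at *
      generalize tu1 (0, t) = r1 at *
      generalize tu2 (0, t) = r2 at *
      have s1' : v1 - tv1 = (p1 - (p1 - r1)) * (Om t - 3 * I * a)
          + p1 * (3 * I * a + 3 * b - k * ((p1 - r1) * conj (p1 - r1)))
          + p2 * (- k * ((p1 - r1) * conj (p2 - r2))) := by
        linear_combination s1 + p1 * B11 + p2 * B21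
      have s2' : v2 - tv2 = (p2 - (p2 - r2)) * (Om t - 3 * I * a)
          + p1 * (- k * (conj (p1 - r1) * (p2 - r2)))
          + p2 * (3 * I * a + 3 * b - k * ((p2 - r2) * conj (p2 - r2))) := by
        linear_combination s2 + p1 * B12 + p2 * B22
      have q1' : z1 = I * (p1 - r1) * (nsq p1 + nsq p2 + nsq r1 + nsq r2)
          + I * ((p1 - (p1 - r1)) * p2 - p1 * (p2 - (p2 - r2))) * (conj p2 - conj (p2 - r2))
          + I * (v1 - (v1 - tv1)) * (Om t - 3 * I * a)
          + I * v1 * (3 * I * a + 3 * b - k * ((p1 - r1) * conj (p1 - r1)))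
          + I * v2 * (- k * ((p1 - r1) * conj (p2 - r2))) := by
        simp only [map_sub] at *
        linear_combination q1 + I * v1 * B11 + I * v2 * B21
          - 3 * (v1 * B 1 1 + v2 * B 2 1) * I_mul_I
      have q2' : z2 = I * (p2 - r2) * (nsq p1 + nsq p2 + nsq r1 + nsq r2)
          + I * (p1 * (p2 - (p2 - r2)) - (p1 - (p1 - r1)) * p2) * (conj p1 - conj (p1 - r1))
          + I * (v2 - (v2 - tv2)) * (Om t - 3 * I * a)
          + I * v1 * (- k * (conj (p1 - r1) * (p2 - r2)))
          + I * v2 * (3 * I * a + 3 * b - k * ((p2 - r2) * conj (p2 - r2))) := by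
        simp only [map_sub] at *
        linear_combination q2 + I * v1 * B12 + I * v2 * B22
          - 3 * (v1 * B 1 2 + v2 * B 2 2) * I_mul_I
      have S1 := congrArg conj s1'
      have S2 := congrArg conj s2'
      have Q1 := congrArg conj q1'
      have Q2 := congrArg conj q2'
      have main := boundary_algebra a b (Om t) k I p1 p2 (p1 - r1) (p2 - r2) v1 v2
        (v1 - tv1) (v2 - tv2) z1 z2 (conj p1) (conj p2) (conj (p1 - r1)) (conj (p2 - r2))
        (conj v1) (conj v2) (conj (v1 - tv1)) (conj (v2 - tv2)) (conj z1) (conj z2)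
        (nsq p1 + nsq p2 + nsq r1 + nsq r2) I_mul_I hR s1' s2'
        (by
          rw [S1]
          simp only [map_add, map_sub, map_mul, map_neg, conj_I, conj_ofReal, conj_conj, map_ofNat]
          ring)
        (by
          rw [S2]
          simp only [map_add, map_sub, map_mul, map_neg, conj_I, conj_ofReal, conj_conj, map_ofNat]
          ring)
        q1' q2'
        (by
          rw [Q1]
          simp only [nsq, map_add, map_sub, map_mul, map_neg, conj_I, conj_ofReal, conj_conj,
            map_ofNat]
          ring)
        (by
          rw [Q2]
          simp only [nsq, map_add, map_sub, map_mul, map_neg, conj_I, conj_ofReal, conj_conj,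
            map_ofNat]
          ring)
      rw [← main]
      simp only [map_sub]
      ring
    have : (((∫ x in Set.Iic (0:ℝ),
        deriv (fun s => Complex.normSq (tu1 (x, s)) + Complex.normSq (tu2 (x, s))) t)
        + (∫ x in Set.Ici (0:ℝ),
        deriv (fun s => Complex.normSq (u1 (x, s)) + Complex.normSq (u2 (x, s))) t)
        - deriv Om t : ℝ) : ℂ) = ((0 : ℝ) : ℂ) := by
      rw [ofReal_sub, ofReal_add, e1, e2, ← fin, ofReal_zero]
      ring
    exact ofReal_injective this
  intro t s
  exact is_const_of_deriv_eq_zero (fun t => (key t).differentiableAt) (fun t => (key t).deriv) t s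
end
end
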